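/- For every N > 0, the satisfiability problem for MSO(<,+1) over the bounded time domain [0,N) is decidable: there is an algorithm that, given an MSO(<,+1) formula φ with free monadic predicates MP and free first-order variables Vars, decides whether there exist a flow f : [0,N) → 𝒫(MP) and an interpretation I : Vars → [0,N) such that f, I ⊨ φ. -/

import Mathlib

namespace HyTime

/-! ### Comparisons and clock constraints -/

/-- Comparison operators `<, ≤, =, ≥, >` used in clock constraints. -/
inductive Cmp where
  | lt | le | eq | ge | gt
  deriving DecidableEq

def Cmp.denote : Cmp → ℝ → ℝ → Prop
  | .lt => fun a b => a < b
  | .le => fun a b => a ≤ b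
  | .eq => fun a b => a = b
  | .ge => fun a b => b ≤ a
  | .gt => fun a b => b < a

def Cmp.code : Cmp → ℕ
  | .lt => 0
  | .le => 1
  | .eq => 2
  | .ge => 3
  | .gt => 4

/-- Clock constraints over one clock: positive boolean combinations of atoms `x ∼ c`,
where the constants `c` come from `α` (naturals, or rationals). -/
inductive ClkC (α : Type) where
  | atom : Cmp → α → ClkC α
  | disj : ClkC α → ClkC α → ClkC α
  | conj : ClkC α → ClkC α → ClkC α
  deriving DecidableEq

namespace ClkC
variable {α β : Type}

/-- Satisfaction of a clock constraint by a clock value `v : ℝ`;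
`toR` interprets the constants as reals. -/
def holds (toR : α → ℝ) (v : ℝ) : ClkC α → Prop
  | .atom c k => c.denote v (toR k)
  | .disj a b => a.holds toR v ∨ b.holds toR v
  | .conj a b => a.holds toR v ∧ b.holds toR v

/-- A missing constraint (`none`) is the trivial constraint. -/
def holdsOpt (toR : α → ℝ) (v : ℝ) : Option (ClkC α) → Prop
  | none => True
  | some c => c.holds toR v

def map (f : α → β) : ClkC α → ClkC β
  | .atom c k => .atom c (f k)
  | .disj a b => .disj (a.map f) (b.map f)
  | .conj a b => .conj (a.map f) (b.map f)

/-- The list of constants appearing in a clock constraint. -/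
def consts : ClkC α → List α
  | .atom _ k => [k]
  | .disj a b => a.consts ++ b.consts
  | .conj a b => a.consts ++ b.consts

end ClkC

/-- The canonical interpretation of natural-number constants as reals. -/
def natR : ℕ → ℝ := fun n => (n : ℝ)

/-- The canonical interpretation of rational constants as reals. -/
def ratR : ℚ → ℝ := fun q => (q : ℝ)

/-! ### Intervals of reals -/

/-- A bounded real interval, with open/closed information at both endpoints. -/
structure TIvl where
  lo : ℝ
  hi : ℝ
  loC : Bool
  hiC : Bool
  deriving Inhabited

namespace TIvl

/-- Membership of a time point in an interval. -/
def Mem (t : ℝ) (I : TIvl) : Prop :=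
  (if I.loC then I.lo ≤ t else I.lo < t) ∧ (if I.hiC then t ≤ I.hi else t < I.hi)

/-- A well-formed (nonempty) interval: either nondegenerate, or a closed singular interval. -/
def WF (I : TIvl) : Prop :=
  I.lo < I.hi ∨ (I.lo = I.hi ∧ I.loC = true ∧ I.hiC = true)

/-- Two intervals are consecutive: they share the endpoint `R(I) = L(J)`,
which belongs to exactly one of them (hence they are disjoint). -/
def Consecutive (I J : TIvl) : Prop := I.hi = J.lo ∧ I.hiC = !J.loC

end TIvl

/-! ### Timed automata (interval-based) -/

/-- An edge of an interval-based timed automaton: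
source, destination, guard (a set of constraints, each over a designated clock), reset set. -/
abbrev IEdge (α : Type) := ℕ × ℕ × List (ℕ × ClkC α) × List ℕ

/-- A timed automaton `A = (V, V₀, α, X, β, E, V_F)` over atomic propositions `props`.
States, propositions and clocks are natural numbers; all components are finite (lists).
`label` is the state labeling, `beta` assigns to (state, clock) pairs a clock constraint. -/
structure TA (α : Type) where
  states : List ℕ
  init : List ℕ
  props : List ℕ
  clocks : List ℕ
  label : List (ℕ × List ℕ)
  beta : List ((ℕ × ℕ) × ClkC α)
  edges : List (IEdge α)
  final : List ℕ

namespace TA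
variable {α β : Type}

def labelOf (A : TA α) (v : ℕ) : List ℕ := (A.label.lookup v).getD []

def betaOf (A : TA α) (v x : ℕ) : Option (ClkC α) :=
  (A.beta.find? (fun q => q.1.1 == v && q.1.2 == x)).map (·.2)

/-- All constants appearing in the constraints of a timed automaton. -/
def consts (A : TA α) : List α :=
  (A.beta.map (·.2)).flatMap ClkC.consts ++
    A.edges.flatMap (fun e => (e.2.2.1.map (·.2)).flatMap ClkC.consts)

/-- Apply a function to every constant of the automaton. -/
def map (f : α → β) (A : TA α) : TA β where
  states := A.states
  init := A.init
  props := A.props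
  clocks := A.clocks
  label := A.label
  beta := A.beta.map (fun q => (q.1, q.2.map f))
  edges := A.edges.map (fun e => (e.1, e.2.1, e.2.2.1.map (fun p => (p.1, p.2.map f)), e.2.2.2))
  final := A.final

end TA

/-! ### Executions of timed automata -/

/-- The raw data of an execution `(v₁,I₁) →^{γ₁}_{Ψ₁} ⋯ →^{γ_{n-1}}_{Ψ_{n-1}} (vₙ,Iₙ)`. -/
structure RawExec (α : Type) where
  states : List ℕ
  ivls : List TIvl
  guards : List (List (ℕ × ClkC α))
  resets : List (List ℕ)
  deriving Inhabited

namespace RawExec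
variable {α : Type}

def n (ρ : RawExec α) : ℕ := ρ.states.length
def ivl (ρ : RawExec α) (i : ℕ) : TIvl := ρ.ivls.getD i default
def state (ρ : RawExec α) (i : ℕ) : ℕ := ρ.states.getD i 0
def reset (ρ : RawExec α) (i : ℕ) : List ℕ := ρ.resets.getD i []
def guard (ρ : RawExec α) (i : ℕ) : List (ℕ × ClkC α) := ρ.guards.getD i []

/-- The `i`-th edge taken by the execution. -/
def edge (ρ : RawExec α) (i : ℕ) : IEdge α := (ρ.state i, ρ.state (i+1), ρ.guard i, ρ.reset i)

/-- The clock valuation `μ_{i+1}` when entering the `(i+1)`-st state: clocks start at `0`,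
advance with elapsed time, and the clocks reset at a transition are set to `0`. -/
def mu (ρ : RawExec α) : ℕ → ℕ → ℝ
  | 0, _ => 0
  | i+1, x => if x ∈ ρ.reset i then 0 else ρ.mu i x + ((ρ.ivl i).hi - (ρ.ivl i).lo)

/-- `t ∈ len(ρ)`. -/
def MemLen (t : ℝ) (ρ : RawExec α) : Prop := ∃ i, i < ρ.n ∧ TIvl.Mem t (ρ.ivl i)

/-- `ρ(t) = v`: at time `t` the execution is at state `v`. -/
def StateAt (ρ : RawExec α) (t : ℝ) (v : ℕ) : Prop :=
  ∃ i, i < ρ.n ∧ TIvl.Mem t (ρ.ivl i) ∧ ρ.state i = v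

/-- `ρ` is an execution of `A`: consistent lengths, an interval sequence starting at `0`,
an initial state, edges of `A`, state constraints throughout each interval, and
guard constraints at the transition times. -/
def IsExec (toR : α → ℝ) (A : TA α) (ρ : RawExec α) : Prop :=
  0 < ρ.n ∧ ρ.ivls.length = ρ.n ∧ ρ.guards.length = ρ.n - 1 ∧ ρ.resets.length = ρ.n - 1 ∧
  (ρ.ivl 0).lo = 0 ∧ (ρ.ivl 0).loC = true ∧
  (∀ i, i < ρ.n → (ρ.ivl i).WF) ∧
  (∀ i, i + 1 < ρ.n → (ρ.ivl i).Consecutive (ρ.ivl (i+1))) ∧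
  ρ.state 0 ∈ A.init ∧
  (∀ i, i + 1 < ρ.n → ρ.edge i ∈ A.edges) ∧
  (∀ i, i < ρ.n → ∀ x ∈ A.clocks, ∀ t : ℝ, TIvl.Mem t (ρ.ivl i) →
    ClkC.holdsOpt toR (ρ.mu i x + t - (ρ.ivl i).lo) (A.betaOf (ρ.state i) x)) ∧
  (∀ i, i + 1 < ρ.n → ∀ q ∈ ρ.guard i,
    ClkC.holds toR (ρ.mu i q.1 + (ρ.ivl i).hi - (ρ.ivl i).lo) q.2)

/-- An accepting execution: ends in a final state. -/
def IsAccExec (toR : α → ℝ) (A : TA α) (ρ : RawExec α) : Prop :=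
  ρ.IsExec toR A ∧ ρ.state (ρ.n - 1) ∈ A.final

/-- The execution is bounded by `N`: no time point `≥ N` belongs to it. -/
def BoundedBy (ρ : RawExec α) (N : ℝ) : Prop := ∀ t : ℝ, N ≤ t → ¬ MemLen t ρ

/-- Membership in `Exec(A)` (if `bd = none`) resp. `Exec_N(A)` (if `bd = some N`). -/
def InSem (toR : α → ℝ) (A : TA α) (bd : Option ℝ) (ρ : RawExec α) : Prop :=
  ρ.IsAccExec toR A ∧ ∀ N, bd = some N → ρ.BoundedBy N

/-- Index of the interval containing `t`. -/
noncomputable def idxAt (ρ : RawExec α) (t : ℝ) : ℕ :=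
  ρ.ivls.findIdx (fun I => @decide (TIvl.Mem t I) (Classical.propDecidable _))

/-- The prefix `ρ|_t` of an execution up to time `t`:
the last interval is intersected with `[0, t]`. -/
noncomputable def prefixUpTo (ρ : RawExec α) (t : ℝ) : RawExec α :=
  let i := ρ.idxAt t
  ⟨ρ.states.take (i + 1),
   ρ.ivls.take i ++ [⟨(ρ.ivl i).lo, t, (ρ.ivl i).loC, true⟩],
   ρ.guards.take i, ρ.resets.take i⟩

/-- Two executions are equal up to time `t` if their prefixes up to `t` are identical. -/
def EqUpTo (ρ₁ ρ₂ : RawExec α) (t : ℝ) : Prop := ρ₁.prefixUpTo t = ρ₂.prefixUpTo t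

end RawExec

/-! ### HCMTL* syntax -/

/-- An interval annotating a temporal operator: endpoints from `α`, with `hi = none`
denoting `∞`. -/
structure FIvl (α : Type) where
  lo : α
  hi : Option α
  loC : Bool
  hiC : Bool

namespace FIvl
variable {α β : Type}

/-- `t ∈ base + I`. -/
def Mem (toR : α → ℝ) (base t : ℝ) (I : FIvl α) : Prop :=
  (if I.loC then base + toR I.lo ≤ t else base + toR I.lo < t) ∧
  (∀ h, I.hi = some h → (if I.hiC then t ≤ base + toR h else t < base + toR h))

/-- A singular interval `[c, c]`. -/
def Singular (I : FIvl α) : Prop := I.loC = true ∧ I.hiC = true ∧ I.hi = some I.lo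

def map (f : α → β) (I : FIvl α) : FIvl β := ⟨f I.lo, I.hi.map f, I.loC, I.hiC⟩

def consts (I : FIvl α) : List α := I.lo :: I.hi.toList

end FIvl

/-- HCMTL* formulas in negation normal form:
`φ ::= p_π | ¬p_π | φ ∨ φ | φ ∧ φ | F_I φ | G_I φ | φ U_I φ | ∃π φ | ∀π φ`.
Propositions and path variables are natural numbers; interval endpoints come from `α`. -/
inductive HF (α : Type) where
  | pos : ℕ → ℕ → HF α
  | neg : ℕ → ℕ → HF α
  | disj : HF α → HF α → HF α
  | conj : HF α → HF α → HF α
  | fut : FIvl α → HF α → HF α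
  | glob : FIvl α → HF α → HF α
  | untl : FIvl α → HF α → HF α → HF α
  | ex : ℕ → HF α → HF α
  | all : ℕ → HF α → HF α

namespace HF
variable {α β : Type}

/-- Free path variables. -/
def free : HF α → Finset ℕ
  | .pos _ π => {π}
  | .neg _ π => {π}
  | .disj a b => a.free ∪ b.free
  | .conj a b => a.free ∪ b.free
  | .fut _ a => a.free
  | .glob _ a => a.free
  | .untl _ a b => a.free ∪ b.free
  | .ex π a => a.free.erase π
  | .all π a => a.free.erase π

/-- A sentence has no free path variables. -/
def Sentence (φ : HF α) : Prop := φ.free = ∅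

/-- Quantifier-free formulas. -/
def QFree : HF α → Prop
  | .pos _ _ => True
  | .neg _ _ => True
  | .disj a b => a.QFree ∧ b.QFree
  | .conj a b => a.QFree ∧ b.QFree
  | .fut _ a => a.QFree
  | .glob _ a => a.QFree
  | .untl _ a b => a.QFree ∧ b.QFree
  | .ex _ _ => False
  | .all _ _ => False

/-- All intervals occurring in the formula are non-singular. -/
def NonSing : HF α → Prop
  | .pos _ _ => True
  | .neg _ _ => True
  | .disj a b => a.NonSing ∧ b.NonSing
  | .conj a b => a.NonSing ∧ b.NonSing
  | .fut I a => ¬ I.Singular ∧ a.NonSing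
  | .glob I a => ¬ I.Singular ∧ a.NonSing
  | .untl I a b => ¬ I.Singular ∧ a.NonSing ∧ b.NonSing
  | .ex _ a => a.NonSing
  | .all _ a => a.NonSing

/-- The HyperMITL fragment: all quantifiers at the top level, all intervals non-singular. -/
def HyperMITL : HF α → Prop
  | .ex _ a => a.HyperMITL
  | .all _ a => a.HyperMITL
  | φ => φ.QFree ∧ φ.NonSing

/-- Apply a function to every interval endpoint of the formula. -/
def map (f : α → β) : HF α → HF β
  | .pos p π => .pos p π
  | .neg p π => .neg p π
  | .disj a b => .disj (a.map f) (b.map f)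
  | .conj a b => .conj (a.map f) (b.map f)
  | .fut I a => .fut (I.map f) (a.map f)
  | .glob I a => .glob (I.map f) (a.map f)
  | .untl I a b => .untl (I.map f) (a.map f) (b.map f)
  | .ex π a => .ex π (a.map f)
  | .all π a => .all π (a.map f)

/-- The list of interval endpoints appearing in the formula. -/
def consts : HF α → List α
  | .pos _ _ => []
  | .neg _ _ => []
  | .disj a b => a.consts ++ b.consts
  | .conj a b => a.consts ++ b.consts
  | .fut I a => I.consts ++ a.consts
  | .glob I a => I.consts ++ a.consts
  | .untl I a b => I.consts ++ a.consts ++ b.consts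
  | .ex _ a => a.consts
  | .all _ a => a.consts

end HF

/-! ### HCMTL* interval-based semantics -/

/-- Time bound restriction: with `bd = some N`, only times `< N` are considered. -/
def inBd : Option ℝ → ℝ → Prop
  | none, _ => True
  | some N, t => t < N

/-- The interval-based satisfaction relation `Π, t, † ⊨_A φ` (with `bd = none`),
resp. its time-bounded variant `Π, t, † ⊨^N_A φ` (with `bd = some N`).
`d = none` represents `† = ε`, and `d = some π` represents `† = π`. -/
def HSat {α : Type} (toR : α → ℝ) (A : TA α) (bd : Option ℝ) :
    HF α → (ℕ → RawExec α) → ℝ → Option ℕ → Prop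
  | .pos p π, Env, t, _ =>
      RawExec.MemLen t (Env π) ∧ ∃ v, RawExec.StateAt (Env π) t v ∧ p ∈ A.labelOf v
  | .neg p π, Env, t, _ =>
      RawExec.MemLen t (Env π) ∧ ∃ v, RawExec.StateAt (Env π) t v ∧ p ∉ A.labelOf v
  | .disj a b, Env, t, d => HSat toR A bd a Env t d ∨ HSat toR A bd b Env t d
  | .conj a b, Env, t, d => HSat toR A bd a Env t d ∧ HSat toR A bd b Env t d
  | .fut I a, Env, t, d => ∃ t', t < t' ∧ inBd bd t' ∧ FIvl.Mem toR t t' I ∧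
      HSat toR A bd a Env t' d
  | .glob I a, Env, t, d => ∀ t', t < t' → inBd bd t' → FIvl.Mem toR t t' I →
      HSat toR A bd a Env t' d
  | .untl I a b, Env, t, d => ∃ t', t < t' ∧ inBd bd t' ∧ FIvl.Mem toR t t' I ∧
      HSat toR A bd b Env t' d ∧ ∀ t'', t < t'' → t'' < t' → HSat toR A bd a Env t'' d
  | .ex π a, Env, t, d => ∃ ρ, RawExec.InSem toR A bd ρ ∧
      ((d = none ∧ t = 0) ∨
        ∃ d₀, d = some d₀ ∧ RawExec.MemLen t (Env d₀) ∧ RawExec.EqUpTo ρ (Env d₀) t) ∧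
      HSat toR A bd a (Function.update Env π ρ) t (some π)
  | .all π a, Env, t, d => ∀ ρ, RawExec.InSem toR A bd ρ →
      ((d = none ∧ t = 0) ∨
        ∃ d₀, d = some d₀ ∧ RawExec.MemLen t (Env d₀) ∧ RawExec.EqUpTo ρ (Env d₀) t) →
      HSat toR A bd a (Function.update Env π ρ) t (some π)

/-! ### MSO(<, +1) -/

/-- MSO(<,+1) formulas over monadic predicate names `σ` and first-order variables `ℕ`:
`φ ::= x < y | +1(x,y) | P(x) | φ ∨ φ | ¬φ | ∃x φ | ∃P φ`. -/
inductive MSO (σ : Type) where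
  | lt : ℕ → ℕ → MSO σ
  | succ : ℕ → ℕ → MSO σ
  | app : σ → ℕ → MSO σ
  | disj : MSO σ → MSO σ → MSO σ
  | neg : MSO σ → MSO σ
  | exFO : ℕ → MSO σ → MSO σ
  | exSO : σ → MSO σ → MSO σ

/-- Continuity of a flow at `t` (within the time domain `D`). -/
def ContAt {σ : Type} (D : Set ℝ) (f : ℝ → Set σ) (t : ℝ) : Prop :=
  ∃ ε : ℝ, 0 < ε ∧ ∀ s ∈ D, |s - t| < ε → f s = f t

/-- A flow is finitely variable: on every bounded interval it has only finitely many
discontinuities. -/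
def FinVar {σ : Type} (D : Set ℝ) (f : ℝ → Set σ) : Prop :=
  ∀ a b : ℝ, Set.Finite {t | t ∈ D ∩ Set.Icc a b ∧ ¬ ContAt D f t}

namespace MSO
variable {σ : Type}

/-- Satisfaction `f, I ⊨ φ` of an MSO(<,+1) formula over the time domain `D`,
by a flow `f` and a first-order interpretation `ivar`. Second-order quantification
ranges over finitely variable flows agreeing with `f` except at the quantified predicate. -/
def Sat (D : Set ℝ) : MSO σ → (ℝ → Set σ) → (ℕ → ℝ) → Prop
  | .lt x y, _, ivar => ivar x < ivar y
  | .succ x y, _, ivar => ivar y = ivar x + 1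
  | .app P x, f, ivar => P ∈ f (ivar x)
  | .disj a b, f, ivar => Sat D a f ivar ∨ Sat D b f ivar
  | .neg a, f, ivar => ¬ Sat D a f ivar
  | .exFO x a, f, ivar => ∃ r ∈ D, Sat D a f (Function.update ivar x r)
  | .exSO P a, f, ivar => ∃ g : ℝ → Set σ, FinVar D g ∧
      (∀ t ∈ D, ∀ Q, Q ≠ P → (Q ∈ g t ↔ Q ∈ f t)) ∧ Sat D a g ivar

/-- Free first-order variables. -/
def freeFO : MSO σ → Finset ℕ
  | .lt x y => {x, y}
  | .succ x y => {x, y}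
  | .app _ x => {x}
  | .disj a b => a.freeFO ∪ b.freeFO
  | .neg a => a.freeFO
  | .exFO x a => a.freeFO.erase x
  | .exSO _ a => a.freeFO

/-- Free monadic (second-order) predicates. -/
def freeSO [DecidableEq σ] : MSO σ → Finset σ
  | .lt _ _ => ∅
  | .succ _ _ => ∅
  | .app P _ => {P}
  | .disj a b => a.freeSO ∪ b.freeSO
  | .neg a => a.freeSO
  | .exFO _ a => a.freeSO
  | .exSO P a => a.freeSO.erase P

/-- Purely first-order formulas: no monadic predicates occur at all. -/
def FOonly : MSO σ → Prop
  | .lt _ _ => True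
  | .succ _ _ => True
  | .app _ _ => False
  | .disj a b => a.FOonly ∧ b.FOonly
  | .neg a => a.FOonly
  | .exFO _ a => a.FOonly
  | .exSO _ _ => False

end MSO

/-! ### The monadic predicates `MP = V ∪ T ∪ R` and the encoding ι of executions as flows -/

/-- The monadic predicates associated to a timed automaton: states `v`, transition markers
`T⁻_e`, `T⁺_e` for edges `e`, and reset markers `R⁰_x`, `R¹_x` for clocks `x`. -/
inductive MPred (α : Type) where
  | st : ℕ → MPred α
  | tminus : IEdge α → MPred α
  | tplus : IEdge α → MPred α
  | r0 : ℕ → MPred α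
  | r1 : ℕ → MPred α
  deriving DecidableEq

/-- The encoding `ι_A` of an execution as a flow over `MP = V ∪ T ∪ R`:
at each time, the current state; at a `T⁻` transition time `t = L(I_{i+1}) ∈ I_{i+1}`,
the marker `T⁻_e` and resets `R⁰_x` (for the clocks `x` reset by `e`);
at a `T⁺` transition time `t = R(I_i) ∈ I_i`, the marker `T⁺_e` and resets `R¹_x`;
and `∅` after the execution has ended. -/
def iota {α : Type} (ρ : RawExec α) (t : ℝ) : Set (MPred α) :=
  {mp | match mp with
    | .st v => RawExec.StateAt ρ t v
    | .tminus e => ∃ i, i + 1 < ρ.n ∧ ρ.edge i = e ∧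
        t = (ρ.ivl (i+1)).lo ∧ TIvl.Mem t (ρ.ivl (i+1))
    | .tplus e => ∃ i, i + 1 < ρ.n ∧ ρ.edge i = e ∧
        t = (ρ.ivl i).hi ∧ TIvl.Mem t (ρ.ivl i)
    | .r0 x => ∃ i, i + 1 < ρ.n ∧ x ∈ ρ.reset i ∧
        t = (ρ.ivl (i+1)).lo ∧ TIvl.Mem t (ρ.ivl (i+1))
    | .r1 x => ∃ i, i + 1 < ρ.n ∧ x ∈ ρ.reset i ∧
        t = (ρ.ivl i).hi ∧ TIvl.Mem t (ρ.ivl i)}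

/-- The combined flow `f_Π` of a path environment `Π` on path variables `1, …, m`,
over the pairwise disjoint indexed copies `MP_1 ∪ ⋯ ∪ MP_m` (tagged by the index). -/
def fPi (m : ℕ) (Env : ℕ → RawExec ℕ) : ℝ → Set (ℕ × MPred ℕ) :=
  fun t => {q | 1 ≤ q.1 ∧ q.1 ≤ m ∧ q.2 ∈ iota (Env q.1) t}

end HyTime

namespace HyTime

/-! ### Timed automata in the point-based semantics -/

/-- A transition of a point-based timed automaton: source state, event (a set of
propositions), guard, reset set, destination state. -/
abbrev PEdge (α : Type) := ℕ × List ℕ × List (ℕ × ClkC α) × List ℕ × ℕ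

def PEdge.src {α : Type} (e : PEdge α) : ℕ := e.1
def PEdge.event {α : Type} (e : PEdge α) : List ℕ := e.2.1
def PEdge.guard {α : Type} (e : PEdge α) : List (ℕ × ClkC α) := e.2.2.1
def PEdge.rst {α : Type} (e : PEdge α) : List ℕ := e.2.2.2.1
def PEdge.dst {α : Type} (e : PEdge α) : ℕ := e.2.2.2.2

/-- A timed automaton in the point-based semantics `B = (𝒫(P), S, s₀, X, Δ, F)`. -/
structure PTA (α : Type) where
  states : List ℕ
  start : ℕ
  props : List ℕ
  clocks : List ℕ
  trans : List (PEdge α)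
  final : List ℕ

/-- The raw data of a run `(s₀,μ₀) →^{e₁,t₁} ⋯ →^{eₙ,tₙ} (sₙ,μₙ)`:
the transitions taken and their times. -/
structure PRun (α : Type) where
  edges : List (PEdge α)
  times : List ℝ
  deriving Inhabited

namespace PRun
variable {α : Type}

def n (η : PRun α) : ℕ := η.edges.length
def edge (η : PRun α) (i : ℕ) : PEdge α := η.edges.getD i default
def time (η : PRun α) (i : ℕ) : ℝ := η.times.getD i 0
def tprev (η : PRun α) (i : ℕ) : ℝ := if i = 0 then 0 else η.time (i - 1)

/-- The clock valuation `μ_i` after `i` transitions. -/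
def mu (η : PRun α) : ℕ → ℕ → ℝ
  | 0, _ => 0
  | i+1, x => if x ∈ PEdge.rst (η.edge i) then 0 else η.mu i x + (η.time i - η.tprev i)

/-- `η` is a run of `B`: nonempty, increasing nonnegative transition times,
starting at the start state, consecutive transitions of `Δ`, guards holding at
transition times. -/
def IsRun (toR : α → ℝ) (B : PTA α) (η : PRun α) : Prop :=
  0 < η.n ∧ η.times.length = η.n ∧
  0 ≤ η.time 0 ∧ (∀ i, i + 1 < η.n → η.time i < η.time (i+1)) ∧
  PEdge.src (η.edge 0) = B.start ∧
  (∀ i, i < η.n → η.edge i ∈ B.trans) ∧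
  (∀ i, i + 1 < η.n → PEdge.src (η.edge (i+1)) = PEdge.dst (η.edge i)) ∧
  (∀ i, i < η.n → ∀ q ∈ PEdge.guard (η.edge i),
    ClkC.holds toR (η.mu i q.1 + (η.time i - η.tprev i)) q.2)

/-- An accepting run: ends in a final state. -/
def IsAccRun (toR : α → ℝ) (B : PTA α) (η : PRun α) : Prop :=
  η.IsRun toR B ∧ PEdge.dst (η.edge (η.n - 1)) ∈ B.final

/-- The duration `len(η) = tₙ` of a run. -/
def len (η : PRun α) : ℝ := η.time (η.n - 1)

/-- All transition times are `< N`. -/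
def BoundedBy (η : PRun α) (N : ℝ) : Prop := ∀ i, i < η.n → η.time i < N

/-- Membership in `Runs(B)` (if `bd = none`) resp. its bounded variant. -/
def InSem (toR : α → ℝ) (B : PTA α) (bd : Option ℝ) (η : PRun α) : Prop :=
  η.IsAccRun toR B ∧ ∀ N, bd = some N → η.BoundedBy N

/-- `t ∈ η`: `t` is one of the transition (event) times of `η`. -/
def EvtTime (η : PRun α) (t : ℝ) : Prop := ∃ i, i < η.n ∧ η.time i = t

/-- `η'` is an extension of `η` from time `t`: they agree on all transitions at
times `≤ t`, and all later transitions (of either run) occur after `t`. -/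
def ExtendsFrom (η' η : PRun α) (t : ℝ) : Prop :=
  ∃ i, i ≤ η.n ∧ i ≤ η'.n ∧
    η'.edges.take i = η.edges.take i ∧ η'.times.take i = η.times.take i ∧
    (∀ j, j < i → η.time j ≤ t) ∧
    (∀ j, i ≤ j → j < η.n → t < η.time j) ∧
    (∀ j, i ≤ j → j < η'.n → t < η'.time j)

end PRun

/-! ### HCMTL* point-based semantics -/

/-- The point-based satisfaction relation `Γ, t, † ⊨_B φ` (with `bd = none`),
resp. its time-bounded variant (with `bd = some N`). `V` is the current set of
path variables (the domain of the environment `Γ`); temporal operators range only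
over event points of the runs in `Γ`. -/
def PSat {α : Type} (toR : α → ℝ) (B : PTA α) (bd : Option ℝ) :
    HF α → Finset ℕ → (ℕ → PRun α) → ℝ → Option ℕ → Prop
  | .pos p π, _, Γ, t, _ =>
      ∃ i, i < (Γ π).n ∧ (Γ π).time i = t ∧ p ∈ PEdge.event ((Γ π).edge i)
  | .neg p π, _, Γ, t, _ =>
      ∃ i, i < (Γ π).n ∧ (Γ π).time i = t ∧ p ∉ PEdge.event ((Γ π).edge i)
  | .disj a b, V, Γ, t, d => PSat toR B bd a V Γ t d ∨ PSat toR B bd b V Γ t d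
  | .conj a b, V, Γ, t, d => PSat toR B bd a V Γ t d ∧ PSat toR B bd b V Γ t d
  | .fut I a, V, Γ, t, d => ∃ t', t < t' ∧ inBd bd t' ∧ FIvl.Mem toR t t' I ∧
      (∃ π ∈ V, PRun.EvtTime (Γ π) t') ∧ PSat toR B bd a V Γ t' d
  | .glob I a, V, Γ, t, d => ∀ t', t < t' → inBd bd t' → FIvl.Mem toR t t' I →
      (∃ π ∈ V, PRun.EvtTime (Γ π) t') → PSat toR B bd a V Γ t' d
  | .untl I a b, V, Γ, t, d => ∃ t', t < t' ∧ inBd bd t' ∧ FIvl.Mem toR t t' I ∧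
      (∃ π ∈ V, PRun.EvtTime (Γ π) t') ∧ PSat toR B bd b V Γ t' d ∧
      (∀ t'', t < t'' → t'' < t' → (∃ π ∈ V, PRun.EvtTime (Γ π) t'') →
        PSat toR B bd a V Γ t'' d)
  | .ex π a, V, Γ, t, d => ∃ η, PRun.InSem toR B bd η ∧
      ((d = none ∧ t = 0) ∨
        ∃ d₀, d = some d₀ ∧ t ≤ PRun.len (Γ d₀) ∧ PRun.ExtendsFrom η (Γ d₀) t) ∧
      PSat toR B bd a (insert π V) (Function.update Γ π η) t (some π)
  | .all π a, V, Γ, t, d => ∀ η, PRun.InSem toR B bd η →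
      ((d = none ∧ t = 0) ∨
        ∃ d₀, d = some d₀ ∧ t ≤ PRun.len (Γ d₀) ∧ PRun.ExtendsFrom η (Γ d₀) t) →
      PSat toR B bd a (insert π V) (Function.update Γ π η) t (some π)

/-! ### Concrete injective encodings of syntax into ℕ -/

def encList {α : Type} (f : α → ℕ) : List α → ℕ
  | [] => 0
  | a :: l => Nat.pair (f a) (encList f l) + 1

def encClkC : ClkC ℕ → ℕ
  | .atom c k => Nat.pair 0 (Nat.pair c.code k)
  | .disj a b => Nat.pair 1 (Nat.pair (encClkC a) (encClkC b))
  | .conj a b => Nat.pair 2 (Nat.pair (encClkC a) (encClkC b))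

def encGuard (g : List (ℕ × ClkC ℕ)) : ℕ := encList (fun q => Nat.pair q.1 (encClkC q.2)) g

def encIEdge (e : IEdge ℕ) : ℕ :=
  Nat.pair e.1 (Nat.pair e.2.1 (Nat.pair (encGuard e.2.2.1) (encList id e.2.2.2)))

/-- Injective encoding of timed automata as natural numbers. -/
def encTA (A : TA ℕ) : ℕ :=
  Nat.pair (encList id A.states) <| Nat.pair (encList id A.init) <|
  Nat.pair (encList id A.props) <| Nat.pair (encList id A.clocks) <|
  Nat.pair (encList (fun q => Nat.pair q.1 (encList id q.2)) A.label) <|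
  Nat.pair (encList (fun q => Nat.pair (Nat.pair q.1.1 q.1.2) (encClkC q.2)) A.beta) <|
  Nat.pair (encList encIEdge A.edges) (encList id A.final)

def encFIvl (I : FIvl ℕ) : ℕ :=
  Nat.pair I.lo <| Nat.pair (match I.hi with | none => 0 | some h => h + 1) <|
  Nat.pair I.loC.toNat I.hiC.toNat

/-- Injective encoding of HCMTL* formulas as natural numbers. -/
def encHF : HF ℕ → ℕ
  | .pos p π => Nat.pair 0 (Nat.pair p π)
  | .neg p π => Nat.pair 1 (Nat.pair p π)
  | .disj a b => Nat.pair 2 (Nat.pair (encHF a) (encHF b))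
  | .conj a b => Nat.pair 3 (Nat.pair (encHF a) (encHF b))
  | .fut I a => Nat.pair 4 (Nat.pair (encFIvl I) (encHF a))
  | .glob I a => Nat.pair 5 (Nat.pair (encFIvl I) (encHF a))
  | .untl I a b => Nat.pair 6 (Nat.pair (encFIvl I) (Nat.pair (encHF a) (encHF b)))
  | .ex π a => Nat.pair 7 (Nat.pair π (encHF a))
  | .all π a => Nat.pair 8 (Nat.pair π (encHF a))

def encPEdge (e : PEdge ℕ) : ℕ :=
  Nat.pair (PEdge.src e) <| Nat.pair (encList id (PEdge.event e)) <|
  Nat.pair (encGuard (PEdge.guard e)) <| Nat.pair (encList id (PEdge.rst e)) (PEdge.dst e)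

/-- Injective encoding of point-based timed automata as natural numbers. -/
def encPTA (B : PTA ℕ) : ℕ :=
  Nat.pair (encList id B.states) <| Nat.pair B.start <| Nat.pair (encList id B.props) <|
  Nat.pair (encList id B.clocks) <| Nat.pair (encList encPEdge B.trans) (encList id B.final)

/-- Injective encoding of MSO(<,+1) formulas as natural numbers. -/
def encMSO : MSO ℕ → ℕ
  | .lt x y => Nat.pair 0 (Nat.pair x y)
  | .succ x y => Nat.pair 1 (Nat.pair x y)
  | .app P x => Nat.pair 2 (Nat.pair P x)
  | .disj a b => Nat.pair 3 (Nat.pair (encMSO a) (encMSO b))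
  | .neg a => Nat.pair 4 (encMSO a)
  | .exFO x a => Nat.pair 5 (Nat.pair x (encMSO a))
  | .exSO P a => Nat.pair 6 (Nat.pair P (encMSO a))

/-! ### The interval-based automaton ⟦B⟧ associated to a point-based automaton B -/

/-- Code of an original state of `B` as a state of `⟦B⟧`. -/
def stCode (s : ℕ) : ℕ := 2 * s
/-- Code of a transition of `B` as a (transition-)state of `⟦B⟧`. -/
def edCode (e : PEdge ℕ) : ℕ := 2 * encPEdge e + 1
/-- The fresh proposition `#` marking transition-states. -/
def hashProp : ℕ := 0
/-- Code of an original proposition of `B` as a proposition of `⟦B⟧`. -/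
def propCode (p : ℕ) : ℕ := 2 * p + 1
/-- Code of a state of `B` as a proposition of `⟦B⟧` (over `P ∪ S ∪ {#}`). -/
def stPropCode (s : ℕ) : ℕ := 2 * s + 2
/-- Code of an original clock of `B` as a clock of `⟦B⟧`. -/
def clkCode (x : ℕ) : ℕ := x + 1
/-- The fresh clock `x_sing` forcing transition-states to be singular. -/
def xsing : ℕ := 0

/-- The interval-based timed automaton `⟦B⟧` over `P ∪ S ∪ {#}`: its states are the
states of `B` together with the transitions of `B`; transition-states are labeled by
their event together with `#`, carry the guard constraints and the constraint
`x_sing = 0`; edges alternate between states and transition-states, resetting `x_sing`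
on entry to a transition-state and the transition's resets on exit. -/
def ibOf (B : PTA ℕ) : TA ℕ where
  states := B.states.map stCode ++ B.trans.map edCode
  init := stCode B.start :: (B.trans.filter (fun e => PEdge.src e == B.start)).map edCode
  props := hashProp :: (B.props.map propCode ++ B.states.map stPropCode)
  clocks := xsing :: B.clocks.map clkCode
  label := B.states.map (fun s => (stCode s, [stPropCode s])) ++
    B.trans.map (fun e => (edCode e, hashProp :: (PEdge.event e).map propCode))
  beta := B.trans.map (fun e => ((edCode e, xsing), ClkC.atom Cmp.eq 0)) ++
    B.trans.flatMap (fun e => B.clocks.filterMap (fun x =>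
      match (PEdge.guard e).filter (fun q => q.1 == x) with
      | [] => none
      | q :: rest =>
          some ((edCode e, clkCode x), rest.foldl (fun acc r => ClkC.conj acc r.2) q.2)))
  edges := B.trans.flatMap (fun e =>
    [(stCode (PEdge.src e), edCode e, [], [xsing]),
     (edCode e, stCode (PEdge.dst e), [], (PEdge.rst e).map clkCode)])
  final := (B.trans.filter (fun e => B.final.contains (PEdge.dst e))).map edCode

/-- The map `χ` sending a run `(s₀,μ₀) →^{e₁,t₁} ⋯ →^{eₙ,tₙ} (sₙ,μₙ)` of `B` to the
execution `(s₀,[0,t₁)), (e₁,[t₁,t₁]), (s₁,(t₁,t₂)), …, (eₙ,[tₙ,tₙ])` of `⟦B⟧`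
(starting at `(e₁,[0,0])` if `t₁ = 0`). -/
noncomputable def chi (η : PRun ℕ) : RawExec ℕ :=
  let n := η.n
  let sts := η.edges.flatMap (fun e => [stCode (PEdge.src e), edCode e])
  let ivls := (List.range n).flatMap (fun i =>
    [⟨η.tprev i, η.time i, decide (i = 0), false⟩, ⟨η.time i, η.time i, true, true⟩])
  let gds : List (List (ℕ × ClkC ℕ)) := List.replicate (2 * n - 1) []
  let rsts := ((List.range n).flatMap
    (fun i => [[xsing], (PEdge.rst (η.edge i)).map clkCode])).take (2 * n - 1)
  if η.time 0 = 0 then ⟨sts.tail, ivls.tail, gds.tail, rsts.tail⟩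
  else ⟨sts, ivls, gds, rsts⟩

end HyTime

namespace HyTime
namespace Stack

variable {K : ℕ}

/-- A letter records, for every track and level, the truth value at a cut point (`false`)
and on the open interval that follows it (`true`). -/
abbrev Letter (K : ℕ) := ℕ → Fin K → Bool → Bool

/-- The letter read at a cut point placed inside the open interval described by `a`. -/
def stut (a : Letter K) : Letter K := fun t k _ => a t k true

/-- Two letters agree on all tracks outside `J`. -/
def EqOff (J : Set ℕ) (a b : Letter K) : Prop := ∀ t, t ∉ J → a t = b t

/-- `w'` arises from `w` by inserting cut points and changing the tracks in `J`. -/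
inductive Refines (J : Set ℕ) : List (Letter K) → List (Letter K) → Prop
  | nil : Refines J [] []
  | cons {a a' : Letter K} {bs w v : List (Letter K)} : EqOff J a a' →
      (∀ b ∈ bs, EqOff J (stut a) b) → Refines J w v → Refines J (a :: w) (a' :: (bs ++ v))

/-- A stacked flow: the truth value of track `t` at time `s + k`, for `s ∈ [0, 1)`. -/
abbrev SFlow (K : ℕ) := ℕ → Fin K → ℝ → Prop

/-- The letter `a` describes the stacked flow `F` on `[s, m)`. -/
def Fits (F : SFlow K) (s m : ℝ) (a : Letter K) : Prop :=
  ∀ t k, (a t k false = true ↔ F t k s) ∧ ∀ r, s < r → r < m → (a t k true = true ↔ F t k r)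

/-- The word describes the stacked flow `F` on `[s, e)`. -/
def Realizes (F : SFlow K) : ℝ → ℝ → List (Letter K) → Prop
  | s, e, [] => s = e
  | s, e, a :: w => ∃ m, s < m ∧ Fits F s m a ∧ Realizes F m e w

theorem Fits.congr {F G : SFlow K} {s m : ℝ} {a : Letter K}
    (h : ∀ t k r, s ≤ r → r < m → (F t k r ↔ G t k r)) (hsm : s < m) (hF : Fits F s m a) :
    Fits G s m a := by
  intro t k
  refine ⟨(hF t k).1.trans (h t k s le_rfl hsm), fun r h1 h2 => ?_⟩
  exact ((hF t k).2 r h1 h2).trans (h t k r h1.le h2)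

theorem Realizes.le {F : SFlow K} {w : List (Letter K)} : ∀ {s e : ℝ}, Realizes F s e w → s ≤ e := by
  induction w with
  | nil => intro s e h; exact le_of_eq h
  | cons a w ih => rintro s e ⟨m, hm, -, h⟩; exact hm.le.trans (ih h)

theorem Realizes.congr {F G : SFlow K} {w : List (Letter K)} : ∀ {s e : ℝ},
    (∀ t k r, s ≤ r → r < e → (F t k r ↔ G t k r)) → Realizes F s e w → Realizes G s e w := by
  induction w with
  | nil => intro s e _ h; exact h
  | cons a w ih =>
    rintro s e hFG ⟨m, hm, hf, h⟩
    refine ⟨m, hm, hf.congr (fun t k r h1 h2 => hFG t k r h1 (h2.trans_le h.le)) hm, ?_⟩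
    exact ih (fun t k r h1 h2 => hFG t k r (hm.le.trans h1) h2) h

theorem Realizes.append {F : SFlow K} {u v : List (Letter K)} : ∀ {s m e : ℝ},
    Realizes F s m u → Realizes F m e v → Realizes F s e (u ++ v) := by
  induction u with
  | nil => intro s m e h1 h2; rw [show s = m from h1]; exact h2
  | cons a u ih => rintro s m e ⟨m', h1, h2, h3⟩ h4; exact ⟨m', h1, h2, ih h3 h4⟩

theorem Realizes.exists_timed {F : SFlow K} {w : List (Letter K)} : ∀ {s e : ℝ},
    Realizes F s e w → ∃ tw : List (Letter K × ℝ × ℝ), tw.map Prod.fst = w ∧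
      (∀ p ∈ tw, s ≤ p.2.1 ∧ p.2.1 < p.2.2 ∧ p.2.2 ≤ e ∧ Fits F p.2.1 p.2.2 p.1) ∧
      tw.Pairwise (fun p q => p.2.2 ≤ q.2.1) ∧
      ∀ r, s ≤ r → r < e → ∃ p ∈ tw, p.2.1 ≤ r ∧ r < p.2.2 := by
  induction w with
  | nil =>
    intro s e h
    refine ⟨[], rfl, by simp, by simp, fun r h1 h2 => ?_⟩
    have : s = e := h
    linarith
  | cons a w ih =>
    rintro s e ⟨m, h1, h2, h3⟩
    obtain ⟨tw, e1, e2, e3, e4⟩ := ih h3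
    refine ⟨(a, s, m) :: tw, by simp [e1], ?_, ?_, ?_⟩
    · intro p hp
      rcases List.mem_cons.1 hp with rfl | hp
      · exact ⟨le_rfl, h1, h3.le, h2⟩
      · obtain ⟨a1, a2, a3, a4⟩ := e2 p hp
        exact ⟨h1.le.trans a1, a2, a3, a4⟩
    · exact List.pairwise_cons.2 ⟨fun p hp => (e2 p hp).1, e3⟩
    · intro r hr1 hr2
      rcases lt_or_ge r m with h | h
      · exact ⟨_, List.mem_cons_self, hr1, h⟩
      · obtain ⟨p, hp, hh⟩ := e4 r h hr2
        exact ⟨p, List.mem_cons_of_mem _ hp, hh⟩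

/-- Inside `(s, e)`, the stacked flow changes only at points of the finite set `Z`. -/
def ConstOff (Z : Finset ℝ) (F : SFlow K) (s e : ℝ) : Prop :=
  ∀ r r', s < r → r < r' → r' < e → (∀ z ∈ Z, z < r ∨ r' < z) → ∀ t k, F t k r ↔ F t k r'

theorem Realizes.constOff {F : SFlow K} {w : List (Letter K)} : ∀ {s e : ℝ},
    Realizes F s e w → ∃ Z, ConstOff Z F s e := by
  induction w with
  | nil =>
    intro s e h
    refine ⟨∅, fun r r' h1 h2 h3 => ?_⟩
    have : s = e := h
    linarith
  | cons a w ih =>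
    rintro s e ⟨m, h1, h2, h3⟩
    obtain ⟨Z, hZ⟩ := ih h3
    refine ⟨insert m Z, fun r r' hs a2 a3 hz t k => ?_⟩
    rcases hz m (by simp) with h | h
    · exact hZ r r' h a2 a3 (fun z hz' => hz z (by simp [hz'])) t k
    · rw [← (h2 t k).2 r hs (a2.trans h), ← (h2 t k).2 r' (hs.trans a2) h]

theorem ConstOff.mono {Z Z' : Finset ℝ} {F : SFlow K} {s e s' e' : ℝ} (h : ConstOff Z F s e)
    (hZ : Z ⊆ Z') (hs : s ≤ s') (he : e' ≤ e) : ConstOff Z' F s' e' :=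
  fun r r' h1 h2 h3 hz => h r r' (hs.trans_lt h1) h2 (h3.trans_le he) fun z hz' => hz z (hZ hz')

theorem ConstOff.exists_word_of_card_le {F : SFlow K} (n : ℕ) : ∀ {Z : Finset ℝ} {s e : ℝ},
    Z.card ≤ n → s < e → ConstOff Z F s e → ∃ a w, Realizes F s e (a :: w) := by
  classical
  have base : ∀ {Z : Finset ℝ} {s e : ℝ}, s < e → ConstOff Z F s e →
      (∀ z ∈ Z, z ≤ s ∨ e ≤ z) → ∃ a w, Realizes F s e (a :: w) := by
    intro Z s e hse h hZ
    refine ⟨fun t k b => decide (if b then F t k ((s + e) / 2) else F t k s), [], e, hse, ?_, rfl⟩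
    intro t k
    refine ⟨by simp, fun r h1 h2 => ?_⟩
    simp only [if_true, decide_eq_true_eq]
    rcases lt_trichotomy r ((s + e) / 2) with h' | h' | h'
    · refine (h r _ h1 h' (by linarith) (fun z hz => ?_) t k).symm
      exact (hZ z hz).imp (fun _ => by linarith) (fun _ => by linarith)
    · rw [h']
    · refine h _ r (by linarith) h' h2 (fun z hz => ?_) t k
      exact (hZ z hz).imp (fun _ => by linarith) (fun _ => by linarith)
  induction n with
  | zero =>
    intro Z s e hc hse h
    have hZ : Z = ∅ := by simpa using hc
    exact base hse h (by simp [hZ])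
  | succ n ih =>
    intro Z s e hc hse h
    by_cases hz : ∃ z ∈ Z, s < z ∧ z < e
    · obtain ⟨z, hzZ, hz1, hz2⟩ := hz
      have hcard : (Z.erase z).card ≤ n := by
        rw [Finset.card_erase_of_mem hzZ]; omega
      obtain ⟨a, u, hu⟩ := ih (s := s) (e := z) hcard hz1 (by
        intro r r' a1 a2 a3 a4
        refine h r r' a1 a2 (a3.trans hz2) (fun y hy => ?_)
        by_cases hyz : y = z
        · subst hyz; exact Or.inr a3
        · exact a4 y (Finset.mem_erase.2 ⟨hyz, hy⟩))
      obtain ⟨b, v, hv⟩ := ih (s := z) (e := e) hcard hz2 (by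
        intro r r' a1 a2 a3 a4
        refine h r r' (hz1.trans a1) a2 a3 (fun y hy => ?_)
        by_cases hyz : y = z
        · subst hyz; exact Or.inl a1
        · exact a4 y (Finset.mem_erase.2 ⟨hyz, hy⟩))
      exact ⟨a, u ++ b :: v, hu.append hv⟩
    · push Not at hz
      refine base hse h (fun z hzZ => ?_)
      rcases le_or_gt z s with h' | h'
      · exact Or.inl h'
      · exact Or.inr (hz z hzZ h')

theorem ConstOff.exists_word {F : SFlow K} {Z : Finset ℝ} {s e : ℝ} (hse : s < e)
    (h : ConstOff Z F s e) : ∃ a w, Realizes F s e (a :: w) :=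
  h.exists_word_of_card_le _ le_rfl hse

/-- Changing the tracks in `J` of a flow is described by a refinement of its word. -/
theorem Realizes.exists_refines {F F' : SFlow K} {J : Set ℕ} {Z : Finset ℝ}
    {w : List (Letter K)} : ∀ {s e : ℝ}, Realizes F s e w → ConstOff Z F' s e →
    (∀ t ∉ J, ∀ k r, s ≤ r → r < e → (F' t k r ↔ F t k r)) →
    ∃ w', Refines J w w' ∧ Realizes F' s e w' := by
  induction w with
  | nil => intro s e h _ _; exact ⟨[], .nil, h⟩
  | cons a w ih =>
    rintro s e ⟨m, h1, h2, h3⟩ hc hF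
    have hme := h3.le
    obtain ⟨w', hw1, hw2⟩ := ih h3 (hc.mono subset_rfl h1.le le_rfl)
      (fun t ht k r a1 a2 => hF t ht k r (h1.le.trans a1) a2)
    obtain ⟨a', bs, hu⟩ := (hc.mono subset_rfl le_rfl hme).exists_word h1
    have hu' := hu
    obtain ⟨m', g1, g2, g3⟩ := hu
    refine ⟨a' :: (bs ++ w'), .cons ?_ ?_ hw1, hu'.append hw2⟩
    · intro t ht
      funext k b
      rw [Bool.eq_iff_iff]
      cases b with
      | false => rw [(h2 t k).1, (g2 t k).1, hF t ht k s le_rfl (h1.trans_le hme)]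
      | true =>
        have hm' := g3.le
        rw [(h2 t k).2 ((s + m') / 2) (by linarith) (by linarith),
          (g2 t k).2 ((s + m') / 2) (by linarith) (by linarith),
          hF t ht k _ (by linarith) (by linarith)]
    · intro b hb t ht
      obtain ⟨tw, e1, e2, -, -⟩ := g3.exists_timed
      rw [← e1] at hb
      obtain ⟨⟨b', s', m''⟩, hp, rfl⟩ := List.mem_map.1 hb
      obtain ⟨q1, q2, q3, q4⟩ := e2 _ hp
      simp only at q1 q2 q3 q4
      funext k c
      rw [Bool.eq_iff_iff]
      cases c with
      | false =>
        rw [(q4 t k).1, hF t ht k _ (by linarith) (by linarith)]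
        exact (h2 t k).2 _ (by linarith) (by linarith)
      | true =>
        rw [(q4 t k).2 ((s' + m'') / 2) (by linarith) (by linarith),
          hF t ht k _ (by linarith) (by linarith)]
        exact (h2 t k).2 _ (by linarith) (by linarith)

/-- On an interval where the tracks outside `J` are constant, any word of letters
compatible with them can be realized by changing the tracks in `J`. -/
theorem exists_realizes_block {F : SFlow K} {J : Set ℕ} {bs : List (Letter K)} :
    ∀ {c a : Letter K} {s m : ℝ}, s < m → Fits F s m c → EqOff J c a →
    (∀ b ∈ bs, EqOff J (stut c) b) →
    ∃ F' : SFlow K, (∀ t ∉ J, F' t = F t) ∧ Realizes F' s m (a :: bs) := by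
  classical
  have one : ∀ {F : SFlow K} {c a : Letter K} {s m : ℝ}, s < m → Fits F s m c → EqOff J c a →
      Fits (fun t k r => if t ∈ J then (if r ≤ s then a t k false = true else a t k true = true)
        else F t k r) s m a := by
    intro F c a s m hsm hc ha t k
    by_cases ht : t ∈ J
    · simp only [ht, if_true, le_refl, true_and]
      intro r h1 h2
      simp [not_le.2 h1]
    · simp only [ht, if_false, ← ha t ht]
      exact hc t k
  induction bs with
  | nil =>
    intro c a s m hsm hc ha _
    exact ⟨_, fun t ht => by simp [ht], m, hsm, one hsm hc ha, rfl⟩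
  | cons b bs ih =>
    intro c a s m hsm hc ha hb
    have h1 : s < (s + m) / 2 := by linarith
    have h2 : (s + m) / 2 < m := by linarith
    have hc' : Fits F ((s + m) / 2) m (stut c) := fun t k =>
      ⟨(hc t k).2 _ h1 h2, fun r a1 a2 => (hc t k).2 r (h1.trans a1) a2⟩
    obtain ⟨F', e1, e2⟩ := ih h2 hc' (hb b List.mem_cons_self)
      (fun b' hb' => hb b' (List.mem_cons_of_mem _ hb'))
    have hcl : Fits F s ((s + m) / 2) c := fun t k =>
      ⟨(hc t k).1, fun r a1 a2 => (hc t k).2 r a1 (a2.trans h2)⟩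
    refine ⟨fun t k r => if r < (s + m) / 2 then (if t ∈ J then (if r ≤ s then a t k false = true
      else a t k true = true) else F t k r) else F' t k r, fun t ht => ?_, (s + m) / 2, h1, ?_, ?_⟩
    · funext k r
      simp [ht, e1 t ht]
    · exact (one h1 hcl ha).congr (fun t k r _ a2 => by simp only [if_pos a2]) h1
    · exact e2.congr (fun t k r a1 _ => by simp only [if_neg (not_lt.2 a1)])

/-- Every refinement of a word is realized by changing the tracks in `J` of the flow. -/
theorem Realizes.of_refines {F : SFlow K} {J : Set ℕ} {w w' : List (Letter K)}
    (hw : Refines J w w') : ∀ {s e : ℝ}, Realizes F s e w →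
    ∃ F' : SFlow K, (∀ t ∉ J, F' t = F t) ∧ Realizes F' s e w' := by
  induction hw with
  | nil => intro s e h; exact ⟨F, fun _ _ => rfl, h⟩
  | cons h1 h2 _ ih =>
    rintro s e ⟨m, g1, g2, g3⟩
    obtain ⟨G, hG1, hG2⟩ := ih g3
    obtain ⟨G', hG1', hG2'⟩ := exists_realizes_block g1 g2 h1 h2
    refine ⟨fun t k r => if r < m then G' t k r else G t k r, fun t ht => ?_, ?_⟩
    · funext k r
      simp [hG1 t ht, hG1' t ht]
    · rw [← List.cons_append]
      refine Realizes.append (m := m) ?_ ?_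
      · exact hG2'.congr fun t k r _ a2 => by simp only [if_pos a2]
      · exact hG2.congr fun t k r a1 _ => by simp only [if_neg (not_lt.2 a1)]

end Stack
end HyTime

namespace HyTime
namespace Stack

variable {K : ℕ}

/-- The variable `x`, represented by track `2 * x + 2`, sits at level `k` of the cut point. -/
def At (x : ℕ) (k : Fin K) (a : Letter K) : Prop :=
  a (2 * x + 2) k false = true ∧ a (2 * x + 2) k true = false

/-- Variable `x` precedes variable `y`. -/
def Before (x y : ℕ) (w : List (Letter K)) : Prop :=
  (∃ k l : Fin K, k < l ∧ (∃ a ∈ w, At x k a) ∧ ∃ b ∈ w, At y l b) ∨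
    ∃ k, ¬ w.Pairwise fun a b => ¬ (At x k a ∧ At y k b)

/-- Variable `x` sits at exactly one place, inside the time domain (track `0`). -/
def Single (x : ℕ) (w : List (Letter K)) : Prop :=
  (∃ a ∈ w, ∃ k, At x k a ∧ a 0 k false = true) ∧
  (∀ a ∈ w, ∀ k, a (2 * x + 2) k true = false) ∧
  (∀ a ∈ w, ∀ k l, At x k a → At x l a → k = l) ∧
  w.Pairwise fun a b => ∀ k l, ¬ (At x k a ∧ At x l b)

/-- Satisfaction of formulas by words; the predicate `P` is represented by track `2 * P + 1`. -/
def Models : MSO ℕ → List (Letter K) → Prop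
  | .lt x y, w => Before x y w
  | .succ x y, w => ∃ a ∈ w, ∃ k l : Fin K, (l : ℕ) = k + 1 ∧ At x k a ∧ At y l a
  | .app P x, w => ∃ a ∈ w, ∃ k, At x k a ∧ a (2 * P + 1) k false = true
  | .disj φ ψ, w => Models φ w ∨ Models ψ w
  | .neg φ, w => ¬ Models φ w
  | .exFO x φ, w => ∃ w', Refines {2 * x + 2} w w' ∧ Single x w' ∧ Models φ w'
  | .exSO P φ, w => ∃ w', Refines {2 * P + 1} w w' ∧ Models φ w'

theorem level_unique {k l : Fin K} {s r : ℝ} (hs : 0 ≤ s) (hs' : s < 1) (hr : 0 ≤ r) (hr' : r < 1)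
    (h : s + k = r + l) : k = l ∧ s = r := by
  have h1 : (k : ℝ) < (l : ℝ) + 1 := by linarith
  have h2 : (l : ℝ) < (k : ℝ) + 1 := by linarith
  have h3 : (k : ℕ) < l + 1 := by exact_mod_cast h1
  have h4 : (l : ℕ) < k + 1 := by exact_mod_cast h2
  have h5 : k = l := Fin.ext (by omega)
  subst h5
  exact ⟨rfl, by linarith⟩

theorem exists_level {N t : ℝ} (hNK : N ≤ K) (ht : t ∈ Set.Ico 0 N) :
    ∃ (k : Fin K) (s : ℝ), 0 ≤ s ∧ s < 1 ∧ t = s + k := by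
  have hk : ⌊t⌋₊ < K := (Nat.floor_lt ht.1).2 (ht.2.trans_le hNK)
  refine ⟨⟨⌊t⌋₊, hk⟩, t - ⌊t⌋₊, ?_, ?_, by simp⟩
  · linarith [Nat.floor_le ht.1]
  · linarith [Nat.lt_floor_add_one t]

/-- Track `2 * x + 2` of the stacked flow is the singleton `{r}`. -/
def PointTrack (F : SFlow K) (x : ℕ) (r : ℝ) : Prop :=
  ∀ (k : Fin K) (s : ℝ), 0 ≤ s → s < 1 → (F (2 * x + 2) k s ↔ r = s + k)

section Point

variable {F : SFlow K} {x : ℕ} {r s m : ℝ} {a : Letter K}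

theorem PointTrack.after (hv : PointTrack F x r) (hs : 0 ≤ s) (hsm : s < m) (hm : m ≤ 1)
    (ha : Fits F s m a) (k : Fin K) : a (2 * x + 2) k true = false := by
  rw [Bool.eq_false_iff]
  intro h
  have h1 := ((ha (2 * x + 2) k).2 (s + (m - s) / 2) (by linarith) (by linarith)).1 h
  have h2 := ((ha (2 * x + 2) k).2 (s + (m - s) / 3) (by linarith) (by linarith)).1 h
  have h3 := (hv k _ (by linarith) (by linarith)).1 h1
  have h4 := (hv k _ (by linarith) (by linarith)).1 h2
  linarith

theorem PointTrack.at_iff (hv : PointTrack F x r) (hs : 0 ≤ s) (hsm : s < m) (hm : m ≤ 1)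
    (ha : Fits F s m a) (k : Fin K) : At x k a ↔ r = s + k := by
  rw [At, (ha _ k).1, hv k s hs (by linarith)]
  simp [hv.after hs hsm hm ha k]

/-- A word together with the intervals on which its letters describe the flow. -/
structure Timed (F : SFlow K) (tw : List (Letter K × ℝ × ℝ)) : Prop where
  mem : ∀ p ∈ tw, 0 ≤ p.2.1 ∧ p.2.1 < p.2.2 ∧ p.2.2 ≤ 1 ∧ Fits F p.2.1 p.2.2 p.1
  ordered : tw.Pairwise (fun p q => p.2.2 ≤ q.2.1)
  cover : ∀ r, 0 ≤ r → r < 1 → ∃ p ∈ tw, p.2.1 ≤ r ∧ r < p.2.2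

theorem PointTrack.exists_mem {tw : List (Letter K × ℝ × ℝ)} (hv : PointTrack F x r)
    (htw : Timed F tw) {k : Fin K} (hs : 0 ≤ s) (hs' : s < 1) (hr : r = s + k) :
    ∃ p ∈ tw, p.2.1 = s := by
  obtain ⟨p, hp, h1, h2⟩ := htw.cover s hs hs'
  refine ⟨p, hp, ?_⟩
  by_contra hne
  obtain ⟨e1, e2, e3, e4⟩ := htw.mem p hp
  have h3 := hv.after e1 e2 e3 e4 k
  have h4 := ((e4 _ k).2 s (lt_of_le_of_ne h1 hne) h2).2 ((hv k s hs hs').2 hr)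
  rw [h3] at h4
  cases h4

end Point

theorem pairwise_trichotomy {α : Type} {R : α → α → Prop} {l : List α} (h : l.Pairwise R)
    {a b : α} (ha : a ∈ l) (hb : b ∈ l) : a = b ∨ R a b ∨ R b a := by
  induction l with
  | nil => simp at ha
  | cons c l ih =>
    obtain ⟨h1, h2⟩ := List.pairwise_cons.1 h
    rcases List.mem_cons.1 ha with e | ha' <;> rcases List.mem_cons.1 hb with e' | hb'
    · exact Or.inl (e.trans e'.symm)
    · exact Or.inr (Or.inl (e ▸ h1 b hb'))
    · exact Or.inr (Or.inr (e' ▸ h1 a ha'))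
    · exact ih h2 ha' hb'

theorem Realizes.timed {F : SFlow K} {w : List (Letter K)} (h : Realizes F 0 1 w) :
    ∃ tw, tw.map Prod.fst = w ∧ Timed F tw := by
  obtain ⟨tw, e1, e2, e3, e4⟩ := h.exists_timed
  exact ⟨tw, e1, e2, e3, e4⟩

theorem before_iff {F : SFlow K} {tw : List (Letter K × ℝ × ℝ)} {x y : ℕ} {r r' N : ℝ}
    (hNK : N ≤ K) (htw : Timed F tw)
    (hx : PointTrack F x r) (hr : r ∈ Set.Ico 0 N) (hy : PointTrack F y r')
    (hr' : r' ∈ Set.Ico 0 N) : Before x y (tw.map Prod.fst) ↔ r < r' := by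
  constructor
  · rintro (⟨k, l, hkl, ⟨a, ha, hxa⟩, b, hb, hyb⟩ | ⟨k, hk⟩)
    · obtain ⟨p, hp, rfl⟩ := List.mem_map.1 ha
      obtain ⟨q, hq, rfl⟩ := List.mem_map.1 hb
      obtain ⟨p1, p2, p3, p4⟩ := htw.mem p hp
      obtain ⟨q1, q2, q3, q4⟩ := htw.mem q hq
      rw [hx.at_iff p1 p2 p3 p4] at hxa
      rw [hy.at_iff q1 q2 q3 q4] at hyb
      have : (k : ℝ) + 1 ≤ l := by exact_mod_cast hkl
      linarith
    · by_contra hlt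
      refine hk (List.pairwise_map.2 (htw.ordered.imp_of_mem ?_))
      rintro p q hp hq hpq ⟨h1, h2⟩
      obtain ⟨p1, p2, p3, p4⟩ := htw.mem p hp
      obtain ⟨q1, q2, q3, q4⟩ := htw.mem q hq
      rw [hx.at_iff p1 p2 p3 p4] at h1
      rw [hy.at_iff q1 q2 q3 q4] at h2
      linarith
  · intro hlt
    obtain ⟨k, s, hs, hs', e⟩ := exists_level hNK hr
    obtain ⟨l, s', hs2, hs2', e'⟩ := exists_level hNK hr'
    obtain ⟨p, hp, hps⟩ := hx.exists_mem htw hs hs' e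
    obtain ⟨q, hq, hqs⟩ := hy.exists_mem htw hs2 hs2' e'
    obtain ⟨p1, p2, p3, p4⟩ := htw.mem p hp
    obtain ⟨q1, q2, q3, q4⟩ := htw.mem q hq
    have hpx : At x k p.1 := (hx.at_iff p1 p2 p3 p4 k).2 (by rw [hps, e])
    have hqy : At y l q.1 := (hy.at_iff q1 q2 q3 q4 l).2 (by rw [hqs, e'])
    rcases lt_trichotomy k l with hkl | hkl | hkl
    · exact Or.inl ⟨k, l, hkl, ⟨p.1, List.mem_map_of_mem hp, hpx⟩, q.1, List.mem_map_of_mem hq, hqy⟩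
    · subst hkl
      refine Or.inr ⟨k, fun hpw => ?_⟩
      rcases pairwise_trichotomy (htw.ordered.and (List.pairwise_map.1 hpw)) hp hq with h | h | h
      · subst h; linarith
      · exact h.2 ⟨hpx, hqy⟩
      · linarith [h.1]
    · have : (l : ℝ) + 1 ≤ k := by exact_mod_cast hkl
      linarith

theorem single_iff {F : SFlow K} {tw : List (Letter K × ℝ × ℝ)} {x : ℕ} {N : ℝ}
    (hNK : N ≤ K) (htw : Timed F tw)
    (hdom : ∀ (k : Fin K) (s : ℝ), 0 ≤ s → s < 1 → (F 0 k s ↔ s + k < N)) :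
    Single x (tw.map Prod.fst) ↔ ∃ r ∈ Set.Ico 0 N, PointTrack F x r := by
  constructor
  · rintro ⟨⟨a, ha, k, hxa, hda⟩, h2, h3, h4⟩
    obtain ⟨p, hp, rfl⟩ := List.mem_map.1 ha
    obtain ⟨p1, p2, p3, p4⟩ := htw.mem p hp
    have hd := (hdom k _ p1 (by linarith)).1 ((p4 0 k).1.1 hda)
    refine ⟨p.2.1 + k, ⟨by positivity, hd⟩, fun l s hs hs' => ⟨fun hF => ?_, fun e => ?_⟩⟩
    · obtain ⟨q, hq, h5, h6⟩ := htw.cover s hs hs'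
      obtain ⟨q1, q2, q3, q4⟩ := htw.mem q hq
      have haft := h2 q.1 (List.mem_map_of_mem hq) l
      have hqs : q.2.1 = s := by
        by_contra hne
        rw [((q4 _ l).2 s (lt_of_le_of_ne h5 hne) h6).2 hF] at haft
        cases haft
      have hql : At x l q.1 := ⟨(q4 _ l).1.2 (by rwa [hqs]), haft⟩
      rcases pairwise_trichotomy (List.pairwise_map.1 h4) hp hq with h | h | h
      · subst h
        rw [hqs, h3 _ ha _ _ hxa hql]
      · exact absurd ⟨hxa, hql⟩ (h k l)
      · exact absurd ⟨hql, hxa⟩ (h l k)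
    · obtain ⟨rfl, rfl⟩ := level_unique p1 (by linarith) hs hs' e
      exact (p4 _ k).1.1 hxa.1
  · rintro ⟨r, hr, hx⟩
    obtain ⟨k, s, hs, hs', e⟩ := exists_level hNK hr
    obtain ⟨p, hp, hps⟩ := hx.exists_mem htw hs hs' e
    refine ⟨⟨p.1, List.mem_map_of_mem hp, k, ?_, ?_⟩, ?_, ?_, ?_⟩
    · obtain ⟨p1, p2, p3, p4⟩ := htw.mem p hp
      exact (hx.at_iff p1 p2 p3 p4 k).2 (by rw [hps, e])
    · obtain ⟨p1, p2, p3, p4⟩ := htw.mem p hp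
      refine (p4 0 k).1.2 ((hdom k _ p1 (by linarith)).2 ?_)
      rw [hps, ← e]
      exact hr.2
    · intro a ha k
      obtain ⟨p, hp, rfl⟩ := List.mem_map.1 ha
      obtain ⟨p1, p2, p3, p4⟩ := htw.mem p hp
      exact hx.after p1 p2 p3 p4 k
    · intro a ha k l h1 h2
      obtain ⟨p, hp, rfl⟩ := List.mem_map.1 ha
      obtain ⟨p1, p2, p3, p4⟩ := htw.mem p hp
      rw [hx.at_iff p1 p2 p3 p4] at h1 h2
      exact (level_unique p1 (by linarith) p1 (by linarith) (h1.symm.trans h2)).1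
    · refine List.pairwise_map.2 (htw.ordered.imp_of_mem ?_)
      rintro p q hp hq hpq k l ⟨h1, h2⟩
      obtain ⟨p1, p2, p3, p4⟩ := htw.mem p hp
      obtain ⟨q1, q2, q3, q4⟩ := htw.mem q hq
      rw [hx.at_iff p1 p2 p3 p4] at h1
      rw [hx.at_iff q1 q2 q3 q4] at h2
      have := (level_unique p1 (by linarith) q1 (by linarith) (h1.symm.trans h2)).2
      linarith

end Stack
end HyTime

namespace HyTime
namespace Stack

variable {K : ℕ}

theorem FinVar.exists_finset {N : ℝ} {g : ℝ → Set ℕ} (h : FinVar (Set.Ico 0 N) g) :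
    ∃ Z : Finset ℝ, ∀ s t, 0 ≤ s → s ≤ t → t < N → (∀ z ∈ Z, z < s ∨ t < z) → g s = g t := by
  refine ⟨(h 0 N).toFinset, fun s t hs hst ht hZ => ?_⟩
  refine (isPreconnected_Icc (a := s) (b := t)).induction₂ (fun a b => g a = g b) ?_ ?_ ?_
    (Set.left_mem_Icc.2 hst) (Set.right_mem_Icc.2 hst)
  · intro x hx
    have hc : ContAt (Set.Ico 0 N) g x := by
      by_contra hc
      have hx0 : 0 ≤ x := hs.trans hx.1
      have hxN : x < N := hx.2.trans_lt ht
      rcases hZ x ((Set.Finite.mem_toFinset _).2 ⟨⟨⟨hx0, hxN⟩, hx0, hxN.le⟩, hc⟩) with h1 | h1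
      · exact absurd hx.1 (not_le.2 h1)
      · exact absurd hx.2 (not_le.2 h1)
    obtain ⟨ε, hε, hc⟩ := hc
    refine Filter.eventually_of_mem (inter_mem_nhdsWithin _ (Metric.ball_mem_nhds x hε)) ?_
    rintro y ⟨hy, hy'⟩
    exact (hc y ⟨hs.trans hy.1, hy.2.trans_lt ht⟩ (by simpa [Real.dist_eq] using hy')).symm
  · exact fun a b c _ _ _ h1 h2 => h1.trans h2
  · exact fun a b _ _ h1 => h1.symm

theorem FinVar.of_finset {N : ℝ} {g : ℝ → Set ℕ} (Z : Finset ℝ)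
    (h : ∀ s t, 0 ≤ s → s < t → t < N → (∀ z ∈ Z, z < s ∨ t < z) → g s = g t) :
    FinVar (Set.Ico 0 N) g := by
  refine fun a b => (Z.finite_toSet).subset ?_
  rintro t ⟨⟨ht, -⟩, hc⟩
  by_contra htZ
  apply hc
  have hopen : IsOpen ((Z : Set ℝ)ᶜ) := Z.finite_toSet.isClosed.isOpen_compl
  obtain ⟨ε, hε, hb⟩ := Metric.isOpen_iff.1 hopen t htZ
  refine ⟨ε, hε, fun s hs hst => ?_⟩
  have hmem : ∀ z ∈ Z, ε ≤ |z - t| := fun z hz => by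
    by_contra hlt
    exact hb (show z ∈ Metric.ball t ε by simpa [Real.dist_eq] using not_le.1 hlt) hz
  rw [abs_lt] at hst
  rcases lt_trichotomy s t with hlt | rfl | hlt
  · refine h s t hs.1 hlt ht.2 fun z hz => ?_
    rcases le_abs.1 (hmem z hz) with h1 | h1
    · exact Or.inr (by linarith)
    · exact Or.inl (by linarith)
  · rfl
  · refine (h t s ht.1 hlt hs.2 fun z hz => ?_).symm
    rcases le_abs.1 (hmem z hz) with h1 | h1
    · exact Or.inr (by linarith)
    · exact Or.inl (by linarith)

/-- All first-order variables and predicates of the formula are below `T`. -/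
def Bounded (T : ℕ) : MSO ℕ → Prop
  | .lt x y => x < T ∧ y < T
  | .succ x y => x < T ∧ y < T
  | .app P x => P < T ∧ x < T
  | .disj φ ψ => Bounded T φ ∧ Bounded T ψ
  | .neg φ => Bounded T φ
  | .exFO x φ => x < T ∧ Bounded T φ
  | .exSO P φ => P < T ∧ Bounded T φ

/-- The stacked flow `F` represents the flow `f` and the interpretation `I`. -/
structure Represents (N : ℝ) (T : ℕ) (F : SFlow K) (f : ℝ → Set ℕ) (I : ℕ → ℝ) : Prop where
  dom : ∀ (k : Fin K) (s : ℝ), 0 ≤ s → s < 1 → (F 0 k s ↔ s + k < N)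
  pred : ∀ P < T, ∀ (k : Fin K) (s : ℝ), 0 ≤ s → s < 1 → s + k < N →
    (F (2 * P + 1) k s ↔ P ∈ f (s + k))
  var : ∀ x < T, I x ∈ Set.Ico 0 N ∧ PointTrack F x (I x)

theorem ConstOff.update {Z Z' : Finset ℝ} {F : SFlow K} {s e : ℝ} (t : ℕ) {p : Fin K → ℝ → Prop}
    [DecidableEq ℝ] (h : ConstOff Z F s e)
    (hp : ∀ r r', s < r → r < r' → r' < e → (∀ z ∈ Z', z < r ∨ r' < z) → ∀ k, p k r ↔ p k r') :
    ConstOff (Z ∪ Z') (Function.update F t p) s e := by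
  intro r r' h1 h2 h3 hz t' k
  by_cases ht : t' = t
  · subst ht
    simp only [Function.update_self]
    exact hp r r' h1 h2 h3 (fun z hz' => hz z (Finset.mem_union_right _ hz')) k
  · simp only [Function.update_of_ne ht]
    exact h r r' h1 h2 h3 (fun z hz' => hz z (Finset.mem_union_left _ hz')) t' k

open Classical in
/-- The cut points in `[0, 1)` induced on some level by the cut points in `Z`. -/
noncomputable def stackCuts (K : ℕ) (Z : Finset ℝ) : Finset ℝ :=
  (Z ×ˢ Finset.range K).image fun p => p.1 - p.2

theorem of_stackCuts {Z : Finset ℝ} {r r' : ℝ} (h : ∀ z ∈ stackCuts K Z, z < r ∨ r' < z)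
    (k : Fin K) {z : ℝ} (hz : z ∈ Z) : z < r + k ∨ r' + k < z := by
  have := h (z - (k : ℕ)) (Finset.mem_image.2
    ⟨(z, k), Finset.mem_product.2 ⟨hz, Finset.mem_range.2 k.2⟩, rfl⟩)
  rcases this with h1 | h1
  · exact Or.inl (by linarith)
  · exact Or.inr (by linarith)

/-- Updating one track of a realized stacked flow. -/
theorem Realizes.exists_update {F : SFlow K} {w : List (Letter K)} (h : Realizes F 0 1 w)
    (t : ℕ) (Z : Finset ℝ) {p : Fin K → ℝ → Prop}
    (hp : ∀ (k : Fin K) (r r' : ℝ), 0 < r → r < r' → r' < 1 →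
      (∀ z ∈ Z, z < r + k ∨ r' + k < z) → (p k r ↔ p k r')) :
    ∃ w', Refines {t} w w' ∧ Realizes (Function.update F t p) 0 1 w' := by
  classical
  obtain ⟨Z', hZ'⟩ := h.constOff
  refine h.exists_refines (hZ'.update (Z' := stackCuts K Z) t ?_) ?_
  · exact fun r r' h1 h2 h3 hz k => hp k r r' h1 h2 h3 fun z => of_stackCuts hz k
  · intro t' ht' k r _ _
    rw [Function.update_of_ne (by simpa using ht')]

theorem Represents.dom_point {N : ℝ} {T : ℕ} {F : SFlow K} {f : ℝ → Set ℕ} {I : ℕ → ℝ}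
    (h : Represents N T F f I) {x : ℕ} (hx : x < T) {k : Fin K} {s : ℝ} (e : I x = s + k) :
    s + k < N := by
  rw [← e]; exact (h.var x hx).1.2

open Classical in
/-- Replacing the predicates in `A` of a flow by those on the tracks of a stacked flow. -/
def readPreds (F : SFlow K) (A : Set ℕ) (f : ℝ → Set ℕ) (t : ℝ) : Set ℕ :=
  {Q | if Q ∈ A then ∃ (k : Fin K) (s : ℝ), 0 ≤ s ∧ s < 1 ∧ t = s + k ∧ F (2 * Q + 1) k s
    else Q ∈ f t}

theorem mem_readPreds {F : SFlow K} {A : Set ℕ} {P : ℕ} (hP : P ∈ A) {f : ℝ → Set ℕ} {k : Fin K}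
    {s : ℝ} (hs : 0 ≤ s) (hs' : s < 1) : P ∈ readPreds F A f (s + k) ↔ F (2 * P + 1) k s := by
  simp only [readPreds, Set.mem_ofPred_eq, hP, if_true]
  constructor
  · rintro ⟨k', s', h1, h2, h3, h4⟩
    obtain ⟨rfl, rfl⟩ := level_unique hs hs' h1 h2 h3
    exact h4
  · exact fun h => ⟨k, s, hs, hs', rfl, h⟩

theorem readPreds_finVar {F : SFlow K} {A : Set ℕ} {f : ℝ → Set ℕ} {N : ℝ} (hNK : N ≤ K)
    {w : List (Letter K)} (hw : Realizes F 0 1 w) (hf : FinVar (Set.Ico 0 N) f) :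
    FinVar (Set.Ico 0 N) (readPreds F A f) := by
  classical
  obtain ⟨Z, hZ⟩ := FinVar.exists_finset hf
  obtain ⟨Z', hZ'⟩ := hw.constOff
  refine FinVar.of_finset (Z ∪ (insert 0 (insert 1 Z') ×ˢ Finset.range K).image
    fun p => p.1 + p.2) fun s t hs hst ht hz => ?_
  have h1 := hZ s t hs hst.le ht fun z hz' => hz z (Finset.mem_union_left _ hz')
  obtain ⟨k, r, hr, hr', rfl⟩ := exists_level hNK (t := s) ⟨hs, hst.trans ht⟩
  have h2 : ∀ z ∈ insert 0 (insert 1 Z'), z < r ∨ t - k < z := fun z hz' => by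
    have := hz (z + (k : ℕ)) (Finset.mem_union_right _ (Finset.mem_image.2
      ⟨(z, k), Finset.mem_product.2 ⟨hz', Finset.mem_range.2 k.2⟩, rfl⟩))
    rcases this with h | h
    · exact Or.inl (by linarith)
    · exact Or.inr (by linarith)
  have h3 : 0 < r := by
    rcases h2 0 (by simp) with h | h
    · exact h
    · linarith
  have h4 : t - k < 1 := by
    rcases h2 1 (by simp) with h | h
    · linarith
    · exact h
  have h5 := hZ' r (t - k) h3 (by linarith) h4 (fun z hz' => h2 z (by simp [hz']))
  ext Q
  have h5 := h5 (2 * Q + 1) k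
  by_cases hQ : Q ∈ A
  · rw [mem_readPreds hQ hr hr', show t = (t - k) + k by ring,
      mem_readPreds hQ (by linarith) h4, h5]
  · simp only [readPreds, Set.mem_ofPred_eq, hQ, if_false, h1]

theorem sat_iff_models {N : ℝ} (hNK : N ≤ K) {T : ℕ} (φ : MSO ℕ) (hφ : Bounded T φ) :
    ∀ {f : ℝ → Set ℕ} {I : ℕ → ℝ} {F : SFlow K} {w : List (Letter K)},
      FinVar (Set.Ico 0 N) f → Realizes F 0 1 w → Represents N T F f I →
      (MSO.Sat (Set.Ico 0 N) φ f I ↔ Models φ w) := by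
  induction φ with
  | lt x y =>
    intro f I F w _ hw hF
    obtain ⟨tw, rfl, htw⟩ := hw.timed
    obtain ⟨hx, hx'⟩ := hF.var x hφ.1
    obtain ⟨hy, hy'⟩ := hF.var y hφ.2
    exact (before_iff hNK htw hx' hx hy' hy).symm
  | succ x y =>
    intro f I F w _ hw hF
    obtain ⟨tw, rfl, htw⟩ := hw.timed
    obtain ⟨hx, hx'⟩ := hF.var x hφ.1
    obtain ⟨hy, hy'⟩ := hF.var y hφ.2
    simp only [MSO.Sat, Models]
    constructor
    · intro h
      obtain ⟨k, s, hs, hs', e⟩ := exists_level hNK hx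
      obtain ⟨p, hp, hps⟩ := hx'.exists_mem htw hs hs' e
      obtain ⟨p1, p2, p3, p4⟩ := htw.mem p hp
      have hk : (k : ℕ) + 1 < K := by
        have : (k : ℝ) + 1 < K := by linarith [hy.2]
        exact_mod_cast this
      refine ⟨p.1, List.mem_map_of_mem hp, k, ⟨k + 1, hk⟩, rfl, ?_, ?_⟩
      · rw [hx'.at_iff p1 p2 p3 p4, hps, e]
      · rw [hy'.at_iff p1 p2 p3 p4, hps, h, e]
        push_cast
        ring
    · rintro ⟨a, ha, k, l, hkl, h1, h2⟩
      obtain ⟨p, hp, rfl⟩ := List.mem_map.1 ha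
      obtain ⟨p1, p2, p3, p4⟩ := htw.mem p hp
      rw [hx'.at_iff p1 p2 p3 p4] at h1
      rw [hy'.at_iff p1 p2 p3 p4] at h2
      rw [h1, h2, hkl]
      push_cast
      ring
  | app P x =>
    intro f I F w _ hw hF
    obtain ⟨tw, rfl, htw⟩ := hw.timed
    obtain ⟨hx, hx'⟩ := hF.var x hφ.2
    simp only [MSO.Sat, Models]
    constructor
    · intro h
      obtain ⟨k, s, hs, hs', e⟩ := exists_level hNK hx
      obtain ⟨p, hp, hps⟩ := hx'.exists_mem htw hs hs' e
      obtain ⟨p1, p2, p3, p4⟩ := htw.mem p hp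
      refine ⟨p.1, List.mem_map_of_mem hp, k, by rw [hx'.at_iff p1 p2 p3 p4, hps, e], ?_⟩
      rw [(p4 _ k).1, hps, hF.pred P hφ.1 k s hs hs' (hF.dom_point hφ.2 e), ← e]
      exact h
    · rintro ⟨a, ha, k, h1, h2⟩
      obtain ⟨p, hp, rfl⟩ := List.mem_map.1 ha
      obtain ⟨p1, p2, p3, p4⟩ := htw.mem p hp
      rw [hx'.at_iff p1 p2 p3 p4] at h1
      rw [(p4 _ k).1, hF.pred P hφ.1 k _ p1 (by linarith) (hF.dom_point hφ.2 h1), ← h1] at h2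
      exact h2
  | disj φ ψ ih1 ih2 =>
    intro f I F w hf hw hF
    exact or_congr (ih1 hφ.1 hf hw hF) (ih2 hφ.2 hf hw hF)
  | neg φ ih =>
    intro f I F w hf hw hF
    exact not_congr (ih hφ hf hw hF)
  | exFO x φ ih =>
    intro f I F w hf hw hF
    have key : ∀ (G : SFlow K) (r : ℝ), (∀ t ∉ ({2 * x + 2} : Set ℕ), G t = F t) →
        r ∈ Set.Ico 0 N → PointTrack G x r → Represents N T G f (Function.update I x r) := by
      intro G r hG hr hx
      refine ⟨?_, ?_, fun y hy => ?_⟩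
      · rw [hG 0 (by simp)]; exact hF.dom
      · intro P hP
        rw [hG (2 * P + 1) (by simp; omega)]; exact hF.pred P hP
      · by_cases hxy : y = x
        · subst hxy
          simp only [Function.update_self]
          exact ⟨hr, hx⟩
        · rw [Function.update_of_ne hxy]
          refine ⟨(hF.var y hy).1, ?_⟩
          unfold PointTrack
          rw [hG (2 * y + 2) (by simp; omega)]
          exact (hF.var y hy).2
    simp only [MSO.Sat, Models]
    constructor
    · rintro ⟨r, hr, h⟩
      obtain ⟨w', h1, h2⟩ := hw.exists_update (2 * x + 2) {r}
        (p := fun k s => r = s + k) fun k s s' _ h4 _ h6 => by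
          rcases h6 r (by simp) with h | h <;> constructor <;> intro h' <;> linarith
      have hx : PointTrack (Function.update F (2 * x + 2) fun k s => r = s + k) x r := by
        intro k s _ _
        simp
      have hrep := key _ r (fun t ht => Function.update_of_ne (by simpa using ht) _ _) hr hx
      refine ⟨w', h1, ?_, (ih hφ.2 hf h2 hrep).1 h⟩
      obtain ⟨tw, rfl, htw⟩ := h2.timed
      exact (single_iff hNK htw hrep.dom).2 ⟨r, hr, hx⟩
    · rintro ⟨w', h1, h2, h3⟩
      obtain ⟨G, hG, hGw⟩ := hw.of_refines h1
      have hdom : ∀ (k : Fin K) (s : ℝ), 0 ≤ s → s < 1 → (G 0 k s ↔ s + k < N) := by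
        rw [hG 0 (by simp)]; exact hF.dom
      obtain ⟨tw, rfl, htw⟩ := hGw.timed
      obtain ⟨r, hr, hx⟩ := (single_iff hNK htw hdom).1 h2
      exact ⟨r, hr, (ih hφ.2 hf hGw (key G r hG hr hx)).2 h3⟩
  | exSO P φ ih =>
    intro f I F w hf hw hF
    have key : ∀ (G : SFlow K) (g : ℝ → Set ℕ), (∀ t ∉ ({2 * P + 1} : Set ℕ), G t = F t) →
        (∀ t ∈ Set.Ico 0 N, ∀ Q, Q ≠ P → (Q ∈ g t ↔ Q ∈ f t)) →
        (∀ (k : Fin K) (s : ℝ), 0 ≤ s → s < 1 → s + k < N →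
          (G (2 * P + 1) k s ↔ P ∈ g (s + k))) → Represents N T G g I := by
      intro G g hG hg hP
      refine ⟨?_, fun Q hQ k s hs hs' hN => ?_, fun y hy => ?_⟩
      · rw [hG 0 (by simp)]; exact hF.dom
      · by_cases hQP : Q = P
        · subst hQP; exact hP k s hs hs' hN
        · rw [hG (2 * Q + 1) (by simp; omega), hg _ ⟨by positivity, hN⟩ Q hQP]
          exact hF.pred Q hQ k s hs hs' hN
      · refine ⟨(hF.var y hy).1, ?_⟩
        unfold PointTrack
        rw [hG (2 * y + 2) (by simp; omega)]
        exact (hF.var y hy).2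
    simp only [MSO.Sat, Models]
    constructor
    · rintro ⟨g, hg, hgf, h⟩
      classical
      obtain ⟨Z, hZ⟩ := FinVar.exists_finset hg
      obtain ⟨w', h1, h2⟩ := hw.exists_update (2 * P + 1) (insert N Z)
        (p := fun k s => s + k < N ∧ P ∈ g (s + k)) fun k s s' h3 h4 h5 h6 => by
          have h8 : 0 ≤ s + (k : ℝ) := by positivity
          rcases h6 N (by simp) with h | h
          · constructor <;> intro h' <;> linarith [h'.1]
          · rw [hZ _ _ h8 (by linarith) h fun z hz => h6 z (by simp [hz])]
            exact and_congr_left' ⟨fun _ => h, fun _ => by linarith⟩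
      refine ⟨w', h1, (ih hφ.2 hg h2 (key _ g (fun t ht => Function.update_of_ne
        (by simpa using ht) _ _) hgf fun k s _ _ hN => ?_)).1 h⟩
      simp [hN]
    · rintro ⟨w', h1, h2⟩
      obtain ⟨G, hG, hGw⟩ := hw.of_refines h1
      have hfin := readPreds_finVar (A := {P}) hNK hGw hf
      have hoff : ∀ t ∈ Set.Ico 0 N, ∀ Q, Q ≠ P → (Q ∈ readPreds G {P} f t ↔ Q ∈ f t) := by
        intro t _ Q hQ
        simp [readPreds, hQ]
      refine ⟨_, hfin, hoff, (ih hφ.2 hfin hGw (key G _ hG hoff fun k s hs hs' _ => ?_)).2 h2⟩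
      exact (mem_readPreds rfl hs hs').symm

end Stack
end HyTime

namespace HyTime
namespace Stack

variable {K : ℕ} {J : Set ℕ}

@[simp] theorem stut_stut (a : Letter K) : stut (stut a) = stut a := rfl

theorem EqOff.stut {a b : Letter K} (h : EqOff J a b) : EqOff J (stut a) (stut b) := by
  intro t ht
  funext k c
  exact congrFun (congrFun (h t ht) k) true

theorem Refines.append {u u' v v' : List (Letter K)} (h : Refines J u u') (h' : Refines J v v') :
    Refines J (u ++ v) (u' ++ v') := by
  induction h with
  | nil => exact h'
  | cons h1 h2 _ ih =>
    simp only [List.cons_append, List.append_assoc]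
    exact .cons h1 h2 ih

theorem refines_append_left {u v w' : List (Letter K)} (h : Refines J (u ++ v) w') :
    ∃ u' v', w' = u' ++ v' ∧ Refines J u u' ∧ Refines J v v' := by
  induction u generalizing w' with
  | nil => exact ⟨[], w', rfl, .nil, h⟩
  | cons a u ih =>
    cases h with
    | @cons _ a' bs _ w₁ h1 h2 h3 =>
      obtain ⟨u', v', rfl, h4, h5⟩ := ih h3
      exact ⟨a' :: (bs ++ u'), v', by simp, .cons h1 h2 h4, h5⟩

/-- `L` does not depend on redundant cut points. -/
def StutterInvariant (L : List (Letter K) → Prop) : Prop :=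
  ∀ x b y, L (x ++ b :: y) ↔ L (x ++ b :: stut b :: y)

/-- A stutter-invariant language all of whose left quotients are among `s` many. -/
structure Regular (s : ℕ) (L : List (Letter K) → Prop) : Prop where
  inv : StutterInvariant L
  idx : ∃ q : List (Letter K) → Fin s, ∀ u v, q u = q v → ∀ z, L (u ++ z) ↔ L (v ++ z)

section Regular

variable {s s' : ℕ} {L L' : List (Letter K) → Prop}

theorem Regular.of_fintype {Q : Type} [Fintype Q] (hs : Fintype.card Q = s)
    (hi : StutterInvariant L) (q : List (Letter K) → Q)
    (hq : ∀ u v, q u = q v → ∀ z, L (u ++ z) ↔ L (v ++ z)) : Regular s L := by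
  subst hs
  exact ⟨hi, fun u => Fintype.equivFin Q (q u), fun u v h => hq u v ((Fintype.equivFin Q).injective h)⟩

theorem Regular.mono (h : Regular s L) (hs : s ≤ s') : Regular s' L := by
  obtain ⟨hi, q, hq⟩ := h
  exact ⟨hi, fun u => Fin.castLE hs (q u), fun u v h => hq u v (Fin.castLE_injective hs h)⟩

theorem Regular.pos (h : Regular s L) : 0 < s := by
  obtain ⟨-, q, -⟩ := h
  exact (q []).pos

theorem Regular.not (h : Regular s L) : Regular s fun w => ¬ L w := by
  obtain ⟨hi, q, hq⟩ := h
  exact ⟨fun x b y => not_congr (hi x b y), q, fun u v h z => not_congr (hq u v h z)⟩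

theorem Regular.or (h : Regular s L) (h' : Regular s' L') :
    Regular (s * s') fun w => L w ∨ L' w := by
  obtain ⟨hi, q, hq⟩ := h
  obtain ⟨hi', q', hq'⟩ := h'
  refine .of_fintype (Q := Fin s × Fin s') (by simp)
    (fun x b y => or_congr (hi x b y) (hi' x b y)) (fun u => (q u, q' u)) fun u v h z => ?_
  rw [Prod.mk.injEq] at h
  exact or_congr (hq u v h.1 z) (hq' u v h.2 z)

theorem Regular.and (h : Regular s L) (h' : Regular s' L') :
    Regular (s * s') fun w => L w ∧ L' w := by
  obtain ⟨hi, q, hq⟩ := h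
  obtain ⟨hi', q', hq'⟩ := h'
  refine .of_fintype (Q := Fin s × Fin s') (by simp)
    (fun x b y => and_congr (hi x b y) (hi' x b y)) (fun u => (q u, q' u)) fun u v h z => ?_
  rw [Prod.mk.injEq] at h
  exact and_congr (hq u v h.1 z) (hq' u v h.2 z)

theorem Regular.exists_fin {n : ℕ} {L : Fin n → List (Letter K) → Prop}
    (h : ∀ i, Regular s (L i)) : Regular (s ^ n) fun w => ∃ i, L i w := by
  choose q hq using fun i => (h i).idx
  refine .of_fintype (Q := Fin n → Fin s) (by simp)
    (fun x b y => exists_congr fun i => (h i).inv x b y) (fun u i => q i u) fun u v h z => ?_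
  exact exists_congr fun i => hq i u v (congrFun h i) z

theorem Regular.forall_fin {n : ℕ} {L : Fin n → List (Letter K) → Prop}
    (h : ∀ i, Regular s (L i)) : Regular (s ^ n) fun w => ∀ i, L i w := by
  simpa using (Regular.exists_fin fun i => (h i).not).not

theorem Regular.const_and (p : Prop) (h : Regular s L) : Regular s fun w => p ∧ L w := by
  obtain ⟨hi, q, hq⟩ := h
  exact ⟨fun x b y => and_congr_right' (hi x b y), q,
    fun u v h z => and_congr_right' (hq u v h z)⟩

theorem Regular.exists_refines (h : Regular s L) :
    Regular (2 ^ s) fun w => ∃ w', Refines J w w' ∧ L w' := by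
  obtain ⟨hi, q, hq⟩ := h
  refine .of_fintype (Q := Set (Fin s)) (by simp) (fun x b y => ⟨?_, ?_⟩)
    (fun u => {i | ∃ u', Refines J u u' ∧ q u' = i}) ?_
  · rintro ⟨w', hw, hL⟩
    obtain ⟨x', z', rfl, hx, hz⟩ := refines_append_left hw
    cases hz with
    | @cons _ b' bs _ w₁ h1 h2 h3 =>
      refine ⟨_, hx.append (.cons (bs := []) h1 (by simp) (.cons h1.stut h2 h3)), ?_⟩
      exact (hi _ _ _).1 hL
  · rintro ⟨w', hw, hL⟩
    obtain ⟨x', z', rfl, hx, hz⟩ := refines_append_left hw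
    cases hz with
    | @cons _ b' bs _ w₁ h1 h2 h3 =>
      cases h3 with
      | @cons _ c' cs _ w₂ g1 g2 g3 =>
        refine ⟨x' ++ b' :: ((bs ++ c' :: cs) ++ w₂), hx.append (.cons h1 ?_ g3), by simpa using hL⟩
        intro d hd
        rcases List.mem_append.1 hd with hd | hd
        · exact h2 d hd
        · rcases List.mem_cons.1 hd with rfl | hd
          · exact g1
          · exact g2 d hd
  · have key : ∀ u v, {i | ∃ u', Refines J u u' ∧ q u' = i} ⊆ {i | ∃ u', Refines J v u' ∧ q u' = i} →
        ∀ z, (∃ w', Refines J (u ++ z) w' ∧ L w') → ∃ w', Refines J (v ++ z) w' ∧ L w' := by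
      rintro u v h z ⟨w', hw, hL⟩
      obtain ⟨u', z', rfl, hu, hz⟩ := refines_append_left hw
      obtain ⟨v', hv, hqv⟩ := h ⟨u', hu, rfl⟩
      exact ⟨v' ++ z', hv.append hz, (hq _ _ hqv _).2 hL⟩
    exact fun u v h z => ⟨key u v h.le z, key v u h.ge z⟩

theorem regular_exists_mem {p : Letter K → Prop} (hp : ∀ a, p (stut a) → p a) :
    Regular 2 fun w => ∃ a ∈ w, p a := by
  classical
  refine .of_fintype (Q := Bool) (by simp) (fun x b y => ?_)
    (fun u => decide (∃ a ∈ u, p a)) fun u v h z => ?_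
  · have hb : p b ∨ p (stut b) ↔ p b := or_iff_left_of_imp (hp b)
    simp only [List.mem_append, List.mem_cons, or_and_right, exists_or, exists_eq_left]
    rw [← or_assoc (a := p b) (b := p (stut b)), hb]
  · rw [decide_eq_decide] at h
    simp only [List.mem_append, or_and_right, exists_or, h]

theorem regular_pairwise {p q : Letter K → Prop} (hp : ∀ a, ¬ p (stut a)) (hq : ∀ a, ¬ q (stut a)) :
    Regular 4 fun w => w.Pairwise fun a b => ¬ (p a ∧ q b) := by
  classical
  refine .of_fintype (Q := Bool × Bool) (by simp) (fun x b y => ?_)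
    (fun u => (decide (∃ a ∈ u, p a), decide (u.Pairwise fun a b => ¬ (p a ∧ q b)))) fun u v h z => ?_
  · have h1 := hp b
    have h2 := hq b
    simp [List.pairwise_append, List.pairwise_cons, h1, h2]
  · simp only [Prod.mk.injEq, decide_eq_decide] at h
    have hcross : ∀ u : List (Letter K), (∀ a ∈ u, ∀ b ∈ z, ¬ (p a ∧ q b)) ↔
        ((∃ a ∈ u, p a) → ∀ b ∈ z, ¬ q b) := by
      intro u
      constructor
      · rintro h ⟨a, ha, hpa⟩ b hb hqb
        exact h a ha b hb ⟨hpa, hqb⟩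
      · rintro h a ha b hb ⟨hpa, hqb⟩
        exact h ⟨a, ha, hpa⟩ b hb hqb
    simp only [List.pairwise_append, hcross, h]

end Regular

theorem not_at_stut (x : ℕ) (k : Fin K) (a : Letter K) : ¬ At x k (stut a) := by
  rintro ⟨h1, h2⟩
  exact absurd (h1.symm.trans h2) (by simp)

theorem exists_regular_before (K : ℕ) :
    ∃ C, ∀ x y, Regular C (fun w : List (Letter K) => Before x y w) := by
  exact ⟨_, fun x y =>
    (Regular.exists_fin fun k => Regular.exists_fin fun l => Regular.const_and _
      ((regular_exists_mem fun a h => absurd h (not_at_stut x k a)).and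
        (regular_exists_mem fun a h => absurd h (not_at_stut y l a)))).or
    (Regular.exists_fin fun k =>
      (regular_pairwise (fun a => not_at_stut x k a) (fun a => not_at_stut y k a)).not)⟩

theorem exists_regular_single (K : ℕ) :
    ∃ C, ∀ x, Regular C (fun w : List (Letter K) => Single x w) := by
  refine ⟨2 * (2 * (2 * 4)), fun x => Regular.and ?_ (Regular.and ?_ (Regular.and ?_ ?_))⟩
  · exact regular_exists_mem fun a ⟨k, h, _⟩ => absurd h (not_at_stut x k a)
  · have := (regular_exists_mem (p := fun a : Letter K => ∃ k, a (2 * x + 2) k true = true)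
      fun a h => h).not
    simpa using this
  · have := (regular_exists_mem (p := fun a : Letter K => ¬ ∀ k l, At x k a → At x l a → k = l)
      fun a h => absurd (fun k l h1 => absurd h1 (not_at_stut x k a)) h).not
    simpa only [not_exists, not_and, not_not] using this
  · have := regular_pairwise (p := fun a : Letter K => ∃ k, At x k a) (q := fun a => ∃ k, At x k a)
      (fun a ⟨k, h⟩ => not_at_stut x k a h) (fun a ⟨k, h⟩ => not_at_stut x k a h)
    have e : ∀ a b : Letter K, (¬ ((∃ k, At x k a) ∧ ∃ k, At x k b)) ↔
        ∀ k l, ¬ (At x k a ∧ At x l b) := fun a b =>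
      ⟨fun h k l h' => h ⟨⟨k, h'.1⟩, l, h'.2⟩, fun h ⟨⟨k, h1⟩, l, h2⟩ => h k l ⟨h1, h2⟩⟩
    simpa only [e] using this

/-- A number of left quotients sufficient for the atomic languages. -/
theorem exists_regular_atoms (K : ℕ) : ∃ C, ∀ x y,
    Regular C (fun w : List (Letter K) => Before x y w) ∧
    Regular C (fun w : List (Letter K) => Single x w) ∧
    Regular C (fun w : List (Letter K) => Models (.succ x y) w) ∧
    Regular C (fun w : List (Letter K) => Models (.app x y) w) := by
  obtain ⟨C₁, h₁⟩ := exists_regular_before K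
  obtain ⟨C₂, h₂⟩ := exists_regular_single K
  refine ⟨C₁ + C₂ + 2, fun x y => ⟨(h₁ x y).mono (by omega), (h₂ x).mono (by omega), ?_, ?_⟩⟩
  · exact (regular_exists_mem fun a ⟨k, l, _, h, _⟩ => absurd h (not_at_stut x k a)).mono (by omega)
  · exact (regular_exists_mem fun a ⟨k, h, _⟩ => absurd h (not_at_stut y k a)).mono (by omega)

/-- A bound on the number of left quotients of formulas with a given code. -/
def idxBound (C : ℕ) : ℕ → ℕ
  | 0 => C
  | n + 1 => 2 ^ (C * (idxBound C n * idxBound C n))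

theorem idxBound_pos {C : ℕ} (hC : 0 < C) : ∀ n, 0 < idxBound C n
  | 0 => hC
  | _ + 1 => by simp [idxBound]

theorem le_mul_mul_self {C B : ℕ} (hC : 0 < C) (hB : 0 < B) : B ≤ C * (B * B) :=
  (Nat.le_mul_of_pos_left B hB).trans (Nat.le_mul_of_pos_left _ hC)

theorem idxBound_mono {C : ℕ} (hC : 0 < C) : Monotone (idxBound C) := by
  refine monotone_nat_of_le_succ fun n => ?_
  exact (le_mul_mul_self hC (idxBound_pos hC n)).trans Nat.lt_two_pow_self.le

theorem models_regular {C : ℕ} (hC : ∀ x y,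
    Regular C (fun w : List (Letter K) => Before x y w) ∧
    Regular C (fun w : List (Letter K) => Single x w) ∧
    Regular C (fun w : List (Letter K) => Models (.succ x y) w) ∧
    Regular C (fun w : List (Letter K) => Models (.app x y) w)) (φ : MSO ℕ) :
    Regular (idxBound C (encMSO φ)) (fun w : List (Letter K) => Models φ w) := by
  have hpos : 0 < C := (hC 0 0).1.pos
  have hm := idxBound_mono hpos
  have hp := idxBound_pos hpos
  have step : ∀ {n m : ℕ}, n < m → ∀ {s}, s ≤ 2 ^ (C * (idxBound C n * idxBound C n)) →
      s ≤ idxBound C m := fun {n m} h {s} hs => hs.trans (hm (show n + 1 ≤ m from h))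
  have lt_pair : ∀ k n m : ℕ, n ≤ m → 0 < k → n < Nat.pair k m := fun k n m h hk =>
    h.trans_lt (by have := Nat.add_le_pair k m; omega)
  induction φ with
  | lt x y => exact (hC x y).1.mono (hm (Nat.zero_le _))
  | succ x y => exact (hC x y).2.2.1.mono (hm (Nat.zero_le _))
  | app P x => exact (hC P x).2.2.2.mono (hm (Nat.zero_le _))
  | disj φ ψ ih1 ih2 =>
    refine (ih1.or ih2).mono (step (n := Nat.pair (encMSO φ) (encMSO ψ))
      (lt_pair _ _ _ le_rfl (by norm_num)) ?_)
    refine (Nat.mul_le_mul (hm (Nat.left_le_pair _ (encMSO ψ)))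
      (hm (Nat.right_le_pair (encMSO φ) _))).trans ?_
    exact (Nat.le_mul_of_pos_left _ hpos).trans Nat.lt_two_pow_self.le
  | neg φ ih =>
    refine ih.not.mono (step (lt_pair _ _ _ le_rfl (by norm_num)) ?_)
    exact (le_mul_mul_self hpos (hp _)).trans Nat.lt_two_pow_self.le
  | exFO x φ ih =>
    refine ((hC x 0).2.1.and ih).exists_refines.mono (step (n := encMSO φ)
      (lt_pair _ _ _ (Nat.right_le_pair _ _) (by norm_num)) ?_)
    exact Nat.pow_le_pow_right (by norm_num)
      (Nat.mul_le_mul_left _ (Nat.le_mul_of_pos_left _ (hp _)))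
  | exSO P φ ih =>
    refine ih.exists_refines.mono (step (n := encMSO φ)
      (lt_pair _ _ _ (Nat.right_le_pair _ _) (by norm_num)) ?_)
    exact Nat.pow_le_pow_right (by norm_num) (le_mul_mul_self hpos (hp _))

/-- Insert `k` redundant cut points after every letter. -/
def pad (k : ℕ) (w : List (Letter K)) : List (Letter K) :=
  w.flatMap fun a => a :: List.replicate k (stut a)

theorem StutterInvariant.replicate {L : List (Letter K) → Prop} (h : StutterInvariant L) (k : ℕ)
    (x : List (Letter K)) (b : Letter K) (y : List (Letter K)) :
    L (x ++ b :: y) ↔ L (x ++ b :: (List.replicate k (stut b) ++ y)) := by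
  induction k with
  | zero => simp
  | succ k ih => rw [ih, h, List.replicate_succ, List.cons_append]

theorem StutterInvariant.pad {L : List (Letter K) → Prop} (h : StutterInvariant L) (k : ℕ) :
    ∀ (x w : List (Letter K)), L (x ++ w) ↔ L (x ++ pad k w) := by
  intro x w
  induction w generalizing x with
  | nil => rfl
  | cons a w ih =>
    rw [h.replicate k, show x ++ a :: (List.replicate k (stut a) ++ w) =
      (x ++ a :: List.replicate k (stut a)) ++ w by simp, ih]
    simp [Stack.pad]

theorem Regular.exists_shorter {s : ℕ} {L : List (Letter K) → Prop} (h : Regular s L)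
    {P : Letter K → Prop} (u z : List (Letter K)) : ∀ (n : ℕ) (bs : List (Letter K)), bs.length ≤ n →
    (∀ b ∈ bs, P b) → L (u ++ bs ++ z) →
    ∃ cs : List (Letter K), cs.length < s ∧ (∀ b ∈ cs, P b) ∧ L (u ++ cs ++ z) := by
  intro n
  induction n with
  | zero =>
    intro bs hn hP hL
    exact ⟨bs, by have := h.pos; omega, hP, hL⟩
  | succ n ih =>
    intro bs hn hP hL
    by_cases hs : bs.length < s
    · exact ⟨bs, hs, hP, hL⟩
    obtain ⟨q, hq⟩ := h.idx
    obtain ⟨i, j, hij, he⟩ := Fintype.exists_ne_map_eq_of_card_lt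
      (fun i : Fin (bs.length + 1) => q (u ++ bs.take i)) (by simp; omega)
    have key : ∀ i j : Fin (bs.length + 1), i < j → q (u ++ bs.take i) = q (u ++ bs.take j) →
        ∃ cs : List (Letter K), cs.length < s ∧ (∀ b ∈ cs, P b) ∧ L (u ++ cs ++ z) := by
      intro i j hij he
      have hj := j.2
      refine ih (bs.take i ++ bs.drop j) ?_ ?_ ?_
      · have : (i : ℕ) < j := hij
        simp only [List.length_append, List.length_take, List.length_drop]
        omega
      · intro b hb
        rcases List.mem_append.1 hb with hb | hb
        · exact hP b (List.mem_of_mem_take hb)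
        · exact hP b (List.mem_of_mem_drop hb)
      · rw [← List.append_assoc, List.append_assoc, hq _ _ he, ← List.append_assoc,
          List.append_assoc u, List.take_append_drop]
        exact hL
    rcases lt_or_gt_of_ne hij with h' | h'
    · exact key i j h' he
    · exact key j i h' he.symm

theorem Regular.exists_block {s k : ℕ} {L : List (Letter K) → Prop} (h : Regular s L) (hk : s ≤ k)
    {a a' : Letter K} {bs : List (Letter K)} (ha : EqOff J a a')
    (hbs : ∀ b ∈ bs, EqOff J (stut a) b) (u z : List (Letter K)) (hL : L (u ++ a' :: (bs ++ z))) :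
    ∃ cs : List (Letter K), cs.length = k ∧ (∀ b ∈ cs, EqOff J (stut a) b) ∧
      L (u ++ a' :: (cs ++ z)) := by
  obtain ⟨cs, h1, h2, h3⟩ := h.exists_shorter (u ++ [a']) z _ bs le_rfl hbs (by simpa using hL)
  rcases List.eq_nil_or_concat cs with rfl | ⟨ds, d, rfl⟩
  · refine ⟨List.replicate k (stut a'), by simp, fun b hb => ?_, ?_⟩
    · rw [List.eq_of_mem_replicate hb]
      exact ha.stut
    · rw [← h.inv.replicate]
      simpa using h3
  · refine ⟨ds ++ d :: List.replicate (k - (ds.length + 1)) (stut d), ?_, fun b hb => ?_, ?_⟩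
    · simp only [List.concat_eq_append, List.length_append, List.length_singleton] at h1
      simp only [List.length_append, List.length_cons, List.length_replicate]
      omega
    · rcases List.mem_append.1 hb with hb | hb
      · exact h2 b (by simp [hb])
      · rcases List.mem_cons.1 hb with rfl | hb
        · exact h2 b (by simp)
        · rw [List.eq_of_mem_replicate hb]
          exact (h2 d (by simp)).stut
    · have := (h.inv.replicate (k - (ds.length + 1)) (u ++ a' :: ds) d z).1 (by simpa using h3)
      simpa using this

theorem Regular.exists_padded {s k : ℕ} {L : List (Letter K) → Prop} (h : Regular s L) (hk : s ≤ k)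
    {w w' : List (Letter K)} (hw : Refines J w w') : ∀ u : List (Letter K), L (u ++ w') →
    ∃ w'', List.Forall₂ (EqOff J) (pad k w) w'' ∧ L (u ++ w'') := by
  induction hw with
  | nil => exact fun u hL => ⟨[], .nil, hL⟩
  | @cons a a' bs w w' h1 h2 _ ih =>
    intro u hL
    obtain ⟨cs, g1, g2, g3⟩ := h.exists_block hk h1 h2 u w' hL
    obtain ⟨v, i1, i2⟩ := ih (u ++ a' :: cs) (by simpa using g3)
    refine ⟨a' :: (cs ++ v), ?_, by simpa using i2⟩
    refine .cons h1 (List.rel_append ?_ i1)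
    rw [← g1]
    clear g1 g3 i2
    induction cs with
    | nil => exact .nil
    | cons c cs ih' =>
      exact .cons (g2 c (by simp)) (ih' fun b hb => g2 b (by simp [hb]))

theorem refines_of_padded {k : ℕ} {w : List (Letter K)} : ∀ {w' : List (Letter K)},
    List.Forall₂ (EqOff J) (pad k w) w' → Refines J w w' := by
  induction w with
  | nil => intro w' h; cases h; exact .nil
  | cons a w ih =>
    intro w' h
    have h : List.Forall₂ (EqOff J) (a :: (List.replicate k (stut a) ++ pad k w)) w' := by
      simpa [pad] using h
    cases h with
    | @cons _ a' _ v h1 h2 =>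
      obtain ⟨bs, z, g1, g2, rfl⟩ : ∃ bs z, List.Forall₂ (EqOff J) (List.replicate k (stut a)) bs ∧
          List.Forall₂ (EqOff J) (pad k w) z ∧ v = bs ++ z :=
        ⟨_, _, (List.forall₂_take_append _ _ _ h2.flip).flip,
          (List.forall₂_drop_append _ _ _ h2.flip).flip,
          (List.take_append_drop _ _).symm⟩
      refine .cons h1 (fun b hb => ?_) (ih g2)
      obtain ⟨i, hi, rfl⟩ := List.getElem_of_mem hb
      have := g1.get (by rw [g1.length_eq]; exact hi) hi
      simpa using this

theorem Regular.exists_refines_iff {s k : ℕ} {L : List (Letter K) → Prop} (h : Regular s L)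
    (hk : s ≤ k) {w : List (Letter K)} :
    (∃ w', Refines J w w' ∧ L w') ↔ ∃ w', List.Forall₂ (EqOff J) (pad k w) w' ∧ L w' :=
  ⟨fun ⟨_, h1, h2⟩ => h.exists_padded hk h1 [] h2, fun ⟨w', h1, h2⟩ => ⟨w', refines_of_padded h1, h2⟩⟩

end Stack
end HyTime

namespace HyTime
namespace Stack

variable {K : ℕ}

/-- The bit of the code `e` for track `t < Tr` of the `i`-th letter at level `k`. -/
def HasBit (Tr e t i k b : ℕ) : Prop :=
  t < Tr ∧ e / 2 ^ Nat.pair t (Nat.pair i (2 * k + b)) % 2 = 1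

open Classical in
/-- The `i`-th letter coded by `e`. -/
noncomputable def letter (K Tr e i : ℕ) : Letter K := fun t k b => decide (HasBit Tr e t i k b.toNat)

/-- The word of length `ℓ` coded by `e`. -/
noncomputable def word (K Tr ℓ e : ℕ) : List (Letter K) := (List.range ℓ).map (letter K Tr e)

@[simp] theorem letter_eq_true {Tr e i t : ℕ} {k : Fin K} {b : Bool} :
    letter K Tr e i t k b = true ↔ HasBit Tr e t i k b.toNat := by
  simp [letter]

def CodeAt (Tr e x i k : ℕ) : Prop :=
  HasBit Tr e (2 * x + 2) i k 0 ∧ ¬ HasBit Tr e (2 * x + 2) i k 1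

theorem at_letter {Tr e i x : ℕ} {k : Fin K} : At x k (letter K Tr e i) ↔ CodeAt Tr e x i k := by
  rw [At, ← Bool.not_eq_true, letter_eq_true, letter_eq_true]
  rfl

def CodeBefore (K Tr ℓ e x y : ℕ) : Prop :=
  (∃ k < K, ∃ l < K, k < l ∧ (∃ i < ℓ, CodeAt Tr e x i k) ∧ ∃ i < ℓ, CodeAt Tr e y i l) ∨
    ∃ k < K, ∃ i < ℓ, ∃ j < ℓ, i < j ∧ CodeAt Tr e x i k ∧ CodeAt Tr e y j k

def CodeSucc (K Tr ℓ e x y : ℕ) : Prop :=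
  ∃ i < ℓ, ∃ k < K, ∃ l < K, l = k + 1 ∧ CodeAt Tr e x i k ∧ CodeAt Tr e y i l

def CodeApp (K Tr ℓ e P x : ℕ) : Prop :=
  ∃ i < ℓ, ∃ k < K, CodeAt Tr e x i k ∧ HasBit Tr e (2 * P + 1) i k 0

def CodeSingle (K Tr ℓ e x : ℕ) : Prop :=
  (∃ i < ℓ, ∃ k < K, CodeAt Tr e x i k ∧ HasBit Tr e 0 i k 0) ∧
  (∀ i < ℓ, ∀ k < K, ¬ HasBit Tr e (2 * x + 2) i k 1) ∧
  (∀ i < ℓ, ∀ k < K, ∀ l < K, ¬ (CodeAt Tr e x i k ∧ CodeAt Tr e x i l ∧ ¬ k = l)) ∧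
  ∀ j < ℓ, ∀ i < j, ∀ k < K, ∀ l < K, ¬ (CodeAt Tr e x i k ∧ CodeAt Tr e x j l)

theorem exists_mem_map_iff {α β : Type*} {f : α → β} {l : List α} {p : β → Prop} :
    (∃ b ∈ l.map f, p b) ↔ ∃ a ∈ l, p (f a) := by
  simp

theorem pairwise_range_iff {n : ℕ} {R : ℕ → ℕ → Prop} :
    (List.range n).Pairwise R ↔ ∀ j < n, ∀ i < j, R i j := by
  rw [List.pairwise_iff_getElem]
  simp only [List.length_range, List.getElem_range]
  exact ⟨fun h j hj i hi => h i j (hi.trans hj) hj hi, fun h i j _ hj hi => h j hj i hi⟩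

section Word

variable {Tr ℓ e : ℕ}

theorem before_word {x y : ℕ} : Before x y (word K Tr ℓ e) ↔ CodeBefore K Tr ℓ e x y := by
  simp only [Before, word, List.pairwise_map, pairwise_range_iff, exists_mem_map_iff,
    List.mem_range, at_letter, CodeBefore, Fin.exists_iff, Fin.lt_def, exists_prop]
  refine or_congr Iff.rfl (exists_congr fun k => and_congr_right fun _ => ?_)
  push Not
  exact ⟨fun ⟨j, hj, i, hi, h⟩ => ⟨i, hi.trans hj, j, hj, hi, h⟩,
    fun ⟨i, _, j, hj, hi, h⟩ => ⟨j, hj, i, hi, h⟩⟩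

theorem succ_word {x y : ℕ} : Models (.succ x y) (word K Tr ℓ e) ↔ CodeSucc K Tr ℓ e x y := by
  simp only [Models, word, exists_mem_map_iff, List.mem_range, at_letter, CodeSucc, Fin.exists_iff,
    exists_prop]

theorem app_word {P x : ℕ} : Models (.app P x) (word K Tr ℓ e) ↔ CodeApp K Tr ℓ e P x := by
  simp only [Models, word, exists_mem_map_iff, List.mem_range, at_letter, CodeApp, Fin.exists_iff,
    exists_prop, letter_eq_true, Bool.toNat_false]

theorem single_word {x : ℕ} : Single x (word K Tr ℓ e) ↔ CodeSingle K Tr ℓ e x := by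
  simp only [Single, word, List.pairwise_map, pairwise_range_iff, exists_mem_map_iff,
    List.forall_mem_map, List.mem_range, at_letter, CodeSingle, Fin.exists_iff, Fin.forall_iff,
    exists_prop, letter_eq_true, Bool.toNat_false, ← Bool.not_eq_true, Bool.toNat_true,
    Fin.mk.injEq, not_and, not_not]

theorem pad_word {p : ℕ} : pad p (word K Tr ℓ e) = (List.range (ℓ * (p + 1))).map fun i =>
    if i % (p + 1) = 0 then letter K Tr e (i / (p + 1)) else stut (letter K Tr e (i / (p + 1))) := by
  induction ℓ with
  | zero => simp [pad, word]
  | succ ℓ ih =>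
    have h : word K Tr (ℓ + 1) e = word K Tr ℓ e ++ [letter K Tr e ℓ] := by
      simp [word, List.range_succ]
    have hpad : ∀ u v : List (Letter K), pad p (u ++ v) = pad p u ++ pad p v := by
      simp [pad]
    rw [h, hpad, ih, Nat.succ_mul, List.range_add, List.map_append, List.map_map]
    congr 1
    rw [List.range_succ_eq_map, List.map_cons, List.map_map]
    simp only [pad, List.flatMap_cons, List.flatMap_nil, List.append_nil]
    congr 1
    · simp
    · refine (List.ext_getElem (by simp) fun i h1 h2 => ?_)
      have hi : i + 1 < p + 1 := by simpa using h1
      have hmod : (ℓ * (p + 1) + (i + 1)) % (p + 1) = i + 1 := by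
        rw [Nat.mul_add_mod_self_right, Nat.mod_eq_of_lt hi]
      have hdiv : (ℓ * (p + 1) + (i + 1)) / (p + 1) = ℓ := by
        rw [mul_comm, Nat.mul_add_div (by omega), Nat.div_eq_of_lt hi, add_zero]
      simp [hmod, hdiv]

/-- The word of `e'` is a padding of the one of `e` by a factor `p`, except on track `j`. -/
def CodeAgree (K Tr ℓ p j e e' : ℕ) : Prop :=
  ∀ i < ℓ * p, ∀ t < Tr, t = j ∨ ∀ k < K, ∀ b < 2,
    (HasBit Tr e' t i k b ↔
      (i % p = 0 ∧ HasBit Tr e t (i / p) k b) ∨ (¬ i % p = 0 ∧ HasBit Tr e t (i / p) k 1))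

theorem codeAgree_iff {p j e' : ℕ} : CodeAgree K Tr ℓ (p + 1) j e e' ↔
    List.Forall₂ (EqOff {j}) (pad p (word K Tr ℓ e)) (word K Tr (ℓ * (p + 1)) e') := by
  rw [pad_word, word, List.forall₂_map_left_iff, List.forall₂_map_right_iff, List.forall₂_same]
  simp only [List.mem_range, CodeAgree]
  refine forall_congr' fun i => imp_congr_right fun _ => ?_
  have key : ∀ t (k : Fin K) (b : Bool),
      ((if i % (p + 1) = 0 then letter K Tr e (i / (p + 1))
        else stut (letter K Tr e (i / (p + 1)))) t k b = letter K Tr e' i t k b ↔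
      (HasBit Tr e' t i k b.toNat ↔ (i % (p + 1) = 0 ∧ HasBit Tr e t (i / (p + 1)) k b.toNat) ∨
        (¬ i % (p + 1) = 0 ∧ HasBit Tr e t (i / (p + 1)) k 1))) := by
    intro t k b
    rw [Bool.eq_iff_iff, letter_eq_true]
    by_cases h : i % (p + 1) = 0
    · simp [h, iff_comm]
    · simp [h, stut, iff_comm]
  constructor
  · intro h t ht
    funext k b
    rw [key]
    by_cases htr : t < Tr
    · have hb : b.toNat < 2 := Bool.toNat_lt b
      exact (h t htr).resolve_left (by simpa using ht) k k.2 _ hb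
    · simp [HasBit, htr]
  · intro h t ht
    by_cases htj : t = j
    · exact Or.inl htj
    refine Or.inr fun k hk b hb => ?_
    have := (key t ⟨k, hk⟩ (b == 1)).1 (by rw [h t (by simpa using htj)])
    have e : (b == 1).toNat = b := by
      interval_cases b <;> rfl
    rwa [e] at this

end Word

/-- A bound for the codes of words. -/
def codeBound (K Tr ℓ : ℕ) : ℕ := 2 ^ Nat.pair Tr (Nat.pair ℓ (2 * K))

theorem exists_code_of_length {Tr : ℕ} (w : List (Letter K))
    (h : ∀ a ∈ w, ∀ t, Tr ≤ t → ∀ k b, a t k b = false) :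
    ∃ e < codeBound K Tr w.length, word K Tr w.length e = w := by
  classical
  let M := Nat.pair Tr (Nat.pair w.length (2 * K))
  let β : ℕ → Bool := fun n => if h : n.unpair.2.unpair.2 < 2 * K
    then w.getD n.unpair.2.unpair.1 (fun _ _ _ => false) n.unpair.1 ⟨n.unpair.2.unpair.2 / 2, by omega⟩
      (n.unpair.2.unpair.2 % 2 == 1) else false
  refine ⟨Nat.ofBits fun i : Fin M => β i, Nat.ofBits_lt_two_pow _, ?_⟩
  refine List.ext_getElem (by simp [word]) fun i h1 h2 => ?_
  funext t k b
  have hw : (word K Tr w.length (Nat.ofBits fun i : Fin M => β i))[i] =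
      letter K Tr (Nat.ofBits fun i : Fin M => β i) i := by
    simp [word]
  rw [hw, Bool.eq_iff_iff, letter_eq_true, HasBit]
  have hb : b.toNat < 2 := Bool.toNat_lt b
  have hk := k.2
  by_cases ht : t < Tr
  · have hlt : Nat.pair t (Nat.pair i (2 * k + b.toNat)) < M :=
      (Nat.pair_lt_pair_left _ ht).trans (Nat.pair_lt_pair_right _
        ((Nat.pair_lt_pair_left _ h2).trans (Nat.pair_lt_pair_right _ (by omega))))
    have hbit := Nat.testBit_ofBits_lt (fun i : Fin M => β i) _ hlt
    rw [Nat.testBit_eq_decide_div_mod_eq] at hbit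
    have hβ : β (Nat.pair t (Nat.pair i (2 * k + b.toNat))) = w[i] t k b := by
      have e1 : (2 * (k : ℕ) + b.toNat) / 2 = k := by omega
      have e2 : ((2 * (k : ℕ) + b.toNat) % 2 == 1) = b := by
        rw [Nat.mul_add_mod, Nat.mod_eq_of_lt hb]
        cases b <;> rfl
      have e3 : 2 * (k : ℕ) + b.toNat < 2 * K := by omega
      simp only [β, Nat.unpair_pair, e1, e2, e3, dif_pos, Fin.eta, List.getD_eq_getElem _ _ h2]
    rw [← hβ, ← hbit]
    simp [ht]
  · simp [ht, h _ (List.getElem_mem h2) t (not_lt.1 ht)]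

theorem exists_code {J : Set ℕ} {Tr : ℕ} {v w : List (Letter K)} (h : List.Forall₂ (EqOff J) v w)
    (hv : ∀ a ∈ v, ∀ t, Tr ≤ t → ∀ k b, a t k b = false) (hJ : ∀ t ∈ J, t < Tr) :
    ∃ e < codeBound K Tr v.length, word K Tr v.length e = w := by
  rw [h.length_eq]
  refine exists_code_of_length w ?_
  induction h with
  | nil => simp
  | cons h1 _ ih =>
    intro a ha t ht k b
    rcases List.mem_cons.1 ha with rfl | ha
    · rw [← h1 t fun hJt => absurd (hJ t hJt) (not_lt.2 ht)]
      exact hv _ List.mem_cons_self t ht k b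
    · exact ih (fun a ha => hv a (List.mem_cons_of_mem _ ha)) a ha t ht k b

theorem pad_word_length {Tr ℓ e p : ℕ} : (pad p (word K Tr ℓ e)).length = ℓ * (p + 1) := by
  simp [pad_word]

theorem pad_word_eq_false {Tr ℓ e p : ℕ} : ∀ a ∈ pad p (word K Tr ℓ e), ∀ t, Tr ≤ t →
    ∀ k b, a t k b = false := by
  intro a ha t ht k b
  have hl : ∀ i, ∀ b, letter K Tr e i t k b = false := fun i b => by
    simp [letter, HasBit, not_lt.2 ht]
  rw [pad_word] at ha
  obtain ⟨i, -, rfl⟩ := List.mem_map.1 ha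
  split_ifs
  · exact hl _ b
  · exact hl _ true

theorem Regular.refines_word_iff {s p ℓ Tr j e : ℕ} {L : List (Letter K) → Prop} (h : Regular s L)
    (hs : s ≤ p) (hj : j < Tr) :
    (∃ w', Refines {j} (word K Tr ℓ e) w' ∧ L w') ↔
      ∃ e' < codeBound K Tr (ℓ * (p + 1)), CodeAgree K Tr ℓ (p + 1) j e e' ∧
        L (word K Tr (ℓ * (p + 1)) e') := by
  rw [h.exists_refines_iff hs]
  constructor
  · rintro ⟨w', h1, h2⟩
    obtain ⟨e', he', rfl⟩ := exists_code h1 pad_word_eq_false (by simpa using hj)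
    rw [pad_word_length] at *
    exact ⟨e', he', codeAgree_iff.2 h1, h2⟩
  · rintro ⟨e', -, h1, h2⟩
    exact ⟨_, codeAgree_iff.1 h1, h2⟩

theorem StutterInvariant.word_iff {p ℓ Tr e : ℕ} {L : List (Letter K) → Prop}
    (h : StutterInvariant L) :
    L (word K Tr ℓ e) ↔
      ∃ e' < codeBound K Tr (ℓ * (p + 1)), CodeAgree K Tr ℓ (p + 1) Tr e e' ∧
        L (word K Tr (ℓ * (p + 1)) e') := by
  have hpad : L (word K Tr ℓ e) ↔ L (Stack.pad p (word K Tr ℓ e)) := h.pad p [] _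
  rw [hpad]
  constructor
  · intro hL
    obtain ⟨e', he', h1⟩ := exists_code_of_length _ (pad_word_eq_false (p := p) (ℓ := ℓ) (e := e))
    rw [pad_word_length] at *
    refine ⟨e', he', codeAgree_iff.2 ?_, by rwa [h1]⟩
    rw [h1]
    exact List.forall₂_same.2 fun _ _ _ _ => rfl
  · rintro ⟨e', -, h1, h2⟩
    convert h2 using 1
    refine List.ext_getElem (by rw [pad_word_length]; simp [word]) fun i g1 g2 => ?_
    funext t
    by_cases ht : t = Tr
    · subst ht
      funext k b
      rw [pad_word_eq_false _ (List.getElem_mem g1) _ le_rfl]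
      have hw : (word K t (ℓ * (p + 1)) e')[i] = letter K t e' i := by simp [word]
      rw [hw]
      simp [letter, HasBit]
    · have := (codeAgree_iff.1 h1).get g1 g2
      exact this t ht

end Stack
end HyTime

namespace HyTime
namespace Stack

section Primrec

open Primrec

variable {α : Type*} [Primcodable α]

theorem primrecPred_exists_mem {p : α → ℕ → Prop} {l : α → List ℕ} (hl : Primrec l)
    (hp : PrimrecPred fun x : α × ℕ => p x.1 x.2) : PrimrecPred fun a => ∃ i ∈ l a, p a i :=
  (PrimrecRel.exists_mem_list (R := fun i a => p a i)
    (PrimrecPred.primrecRel (hp.comp (.pair .snd .fst)))).comp hl .id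

theorem primrecPred_exists_lt {p : α → ℕ → Prop} {b : α → ℕ} (hb : Primrec b)
    (hp : PrimrecPred fun x : α × ℕ => p x.1 x.2) : PrimrecPred fun a => ∃ i < b a, p a i :=
  (primrecPred_exists_mem (list_range.comp hb) hp).of_eq fun a => by simp

theorem primrecPred_forall_lt {p : α → ℕ → Prop} {b : α → ℕ} (hb : Primrec b)
    (hp : PrimrecPred fun x : α × ℕ => p x.1 x.2) : PrimrecPred fun a => ∀ i < b a, p a i :=
  (primrecPred_exists_lt (p := fun a i => ¬ p a i) hb hp.not).not.of_eq fun a => by simp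

theorem primrec_filter {p : α → ℕ → Prop} [DecidableRel p] {l : α → List ℕ} (hl : Primrec l)
    (hp : PrimrecPred fun x : α × ℕ => p x.1 x.2) : Primrec fun a => (l a).filter (p a ·) := by
  have h := (PrimrecRel.listFilter (R := fun i a => p a i)
    (PrimrecPred.primrecRel (hp.comp (.pair .snd .fst)))).comp hl .id
  exact h

theorem primrec_pow : Primrec₂ ((· ^ ·) : ℕ → ℕ → ℕ) :=
  Primrec₂.unpaired'.1 Nat.Primrec.pow

theorem primrecPred_imp {p q : α → Prop} (hp : PrimrecPred p) (hq : PrimrecPred q) :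
    PrimrecPred fun a => p a → q a :=
  (hp.not.or hq).of_eq fun _ => imp_iff_not_or.symm

theorem primrecPred_iff {p q : α → Prop} (hp : PrimrecPred p) (hq : PrimrecPred q) :
    PrimrecPred fun a => p a ↔ q a :=
  ((primrecPred_imp hp hq).and (primrecPred_imp hq hp)).of_eq fun _ => iff_iff_implies_and_implies.symm

variable {K : ℕ} {Tr ℓ e : α → ℕ}

theorem primrecPred_hasBit {t i k b : α → ℕ} (hT : Primrec Tr) (he : Primrec e) (ht : Primrec t)
    (hi : Primrec i) (hk : Primrec k) (hb : Primrec b) :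
    PrimrecPred fun a => HasBit (Tr a) (e a) (t a) (i a) (k a) (b a) :=
  (nat_lt.comp ht hT).and (Primrec.eq.comp (nat_mod.comp (nat_div.comp he (primrec_pow.comp
    (.const 2) (Primrec₂.natPair.comp ht (Primrec₂.natPair.comp hi
      (nat_add.comp (nat_mul.comp (.const 2) hk) hb))))) (.const 2)) (.const 1))

theorem primrecPred_codeAt {x i k : α → ℕ} (hT : Primrec Tr) (he : Primrec e) (hx : Primrec x)
    (hi : Primrec i) (hk : Primrec k) : PrimrecPred fun a => CodeAt (Tr a) (e a) (x a) (i a) (k a) :=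
  have hx' := nat_add.comp (nat_mul.comp (.const 2) hx) (.const 2)
  (primrecPred_hasBit hT he hx' hi hk (.const 0)).and
    (primrecPred_hasBit hT he hx' hi hk (.const 1)).not

theorem primrecPred_codeBefore {x y : α → ℕ} (hT : Primrec Tr) (hℓ : Primrec ℓ) (he : Primrec e)
    (hx : Primrec x) (hy : Primrec y) :
    PrimrecPred fun a => CodeBefore K (Tr a) (ℓ a) (e a) (x a) (y a) := by
  have f2 : Primrec fun x : (α × ℕ) × ℕ => x.1.1 := fst.comp fst
  have f3 : Primrec fun x : ((α × ℕ) × ℕ) × ℕ => x.1.1.1 := fst.comp (fst.comp fst)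
  refine .or (primrecPred_exists_lt (.const K) (primrecPred_exists_lt (.const K)
    (.and (nat_lt.comp (snd.comp fst) snd) (.and ?_ ?_))))
    (primrecPred_exists_lt (.const K) (primrecPred_exists_lt (hℓ.comp fst)
      (primrecPred_exists_lt (hℓ.comp f2) (.and (nat_lt.comp (snd.comp fst) snd) (.and ?_ ?_)))))
  · exact primrecPred_exists_lt (hℓ.comp f2) (primrecPred_codeAt (hT.comp f3) (he.comp f3)
      (hx.comp f3) snd (snd.comp (fst.comp fst)))
  · exact primrecPred_exists_lt (hℓ.comp f2) (primrecPred_codeAt (hT.comp f3) (he.comp f3)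
      (hy.comp f3) snd (snd.comp fst))
  · exact primrecPred_codeAt (hT.comp f3) (he.comp f3) (hx.comp f3) (snd.comp fst)
      (snd.comp (fst.comp fst))
  · exact primrecPred_codeAt (hT.comp f3) (he.comp f3) (hy.comp f3) snd (snd.comp (fst.comp fst))

theorem primrecPred_codeSucc {x y : α → ℕ} (hT : Primrec Tr) (hℓ : Primrec ℓ) (he : Primrec e)
    (hx : Primrec x) (hy : Primrec y) :
    PrimrecPred fun a => CodeSucc K (Tr a) (ℓ a) (e a) (x a) (y a) := by
  have f3 : Primrec fun x : ((α × ℕ) × ℕ) × ℕ => x.1.1.1 := fst.comp (fst.comp fst)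
  refine primrecPred_exists_lt hℓ (primrecPred_exists_lt (.const K)
    (primrecPred_exists_lt (.const K)
      (.and (Primrec.eq.comp snd (succ.comp (snd.comp fst))) (.and ?_ ?_))))
  · exact primrecPred_codeAt (hT.comp f3) (he.comp f3) (hx.comp f3) (snd.comp (fst.comp fst))
      (snd.comp fst)
  · exact primrecPred_codeAt (hT.comp f3) (he.comp f3) (hy.comp f3) (snd.comp (fst.comp fst)) snd

theorem primrecPred_codeApp {P x : α → ℕ} (hT : Primrec Tr) (hℓ : Primrec ℓ) (he : Primrec e)
    (hP : Primrec P) (hx : Primrec x) :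
    PrimrecPred fun a => CodeApp K (Tr a) (ℓ a) (e a) (P a) (x a) := by
  have f2 : Primrec fun x : (α × ℕ) × ℕ => x.1.1 := fst.comp fst
  refine primrecPred_exists_lt hℓ (primrecPred_exists_lt (.const K) (.and ?_ ?_))
  · exact primrecPred_codeAt (hT.comp f2) (he.comp f2) (hx.comp f2) (snd.comp fst) snd
  · exact primrecPred_hasBit (hT.comp f2) (he.comp f2)
      (nat_add.comp (nat_mul.comp (.const 2) (hP.comp f2)) (.const 1)) (snd.comp fst) snd (.const 0)

theorem primrecPred_codeSingle {x : α → ℕ} (hT : Primrec Tr) (hℓ : Primrec ℓ) (he : Primrec e)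
    (hx : Primrec x) : PrimrecPred fun a => CodeSingle K (Tr a) (ℓ a) (e a) (x a) := by
  have f2 : Primrec fun x : (α × ℕ) × ℕ => x.1.1 := fst.comp fst
  have f3 : Primrec fun x : ((α × ℕ) × ℕ) × ℕ => x.1.1.1 := fst.comp (fst.comp fst)
  have f4 : Primrec fun x : (((α × ℕ) × ℕ) × ℕ) × ℕ => x.1.1.1.1 :=
    fst.comp (fst.comp (fst.comp fst))
  refine .and (primrecPred_exists_lt hℓ (primrecPred_exists_lt (.const K) (.and ?_ ?_)))
    (.and (primrecPred_forall_lt hℓ (primrecPred_forall_lt (.const K) (.not ?_)))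
    (.and (primrecPred_forall_lt hℓ (primrecPred_forall_lt (.const K)
      (primrecPred_forall_lt (.const K) (.not (.and ?_ (.and ?_ (.not ?_)))))))
    (primrecPred_forall_lt hℓ (primrecPred_forall_lt snd (primrecPred_forall_lt (.const K)
      (primrecPred_forall_lt (.const K) (.not (.and ?_ ?_))))))))
  · exact primrecPred_codeAt (hT.comp f2) (he.comp f2) (hx.comp f2) (snd.comp fst) snd
  · exact primrecPred_hasBit (hT.comp f2) (he.comp f2) (.const 0) (snd.comp fst) snd (.const 0)
  · exact primrecPred_hasBit (hT.comp f2) (he.comp f2)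
      (nat_add.comp (nat_mul.comp (.const 2) (hx.comp f2)) (.const 2)) (snd.comp fst) snd (.const 1)
  · exact primrecPred_codeAt (hT.comp f3) (he.comp f3) (hx.comp f3) (snd.comp (fst.comp fst))
      (snd.comp fst)
  · exact primrecPred_codeAt (hT.comp f3) (he.comp f3) (hx.comp f3) (snd.comp (fst.comp fst)) snd
  · exact Primrec.eq.comp (snd.comp fst) snd
  · exact primrecPred_codeAt (hT.comp f4) (he.comp f4) (hx.comp f4) (snd.comp (fst.comp fst))
      (snd.comp fst)
  · exact primrecPred_codeAt (hT.comp f4) (he.comp f4) (hx.comp f4)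
      (snd.comp (fst.comp (fst.comp fst))) snd

theorem primrecPred_codeAgree {p j e' : α → ℕ} (hT : Primrec Tr) (hℓ : Primrec ℓ) (hp : Primrec p)
    (hj : Primrec j) (he : Primrec e) (he' : Primrec e') :
    PrimrecPred fun a => CodeAgree K (Tr a) (ℓ a) (p a) (j a) (e a) (e' a) := by
  have f2 : Primrec fun x : (α × ℕ) × ℕ => x.1.1 := fst.comp fst
  have f4 : Primrec fun x : (((α × ℕ) × ℕ) × ℕ) × ℕ => x.1.1.1.1 :=
    fst.comp (fst.comp (fst.comp fst))
  have i4 : Primrec fun x : (((α × ℕ) × ℕ) × ℕ) × ℕ => x.1.1.1.2 :=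
    snd.comp (fst.comp (fst.comp fst))
  have t4 : Primrec fun x : (((α × ℕ) × ℕ) × ℕ) × ℕ => x.1.1.2 := snd.comp (fst.comp fst)
  have k4 : Primrec fun x : (((α × ℕ) × ℕ) × ℕ) × ℕ => x.1.2 := snd.comp fst
  have hdvd : PrimrecPred fun x : (((α × ℕ) × ℕ) × ℕ) × ℕ => x.1.1.1.2 % p x.1.1.1.1 = 0 :=
    Primrec.eq.comp (nat_mod.comp i4 (hp.comp f4)) (.const 0)
  have hdiv := nat_div.comp i4 (hp.comp f4)
  refine primrecPred_forall_lt (nat_mul.comp hℓ hp) (primrecPred_forall_lt (hT.comp fst)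
    (.or (Primrec.eq.comp snd (hj.comp f2)) (primrecPred_forall_lt (.const K)
      (primrecPred_forall_lt (.const 2) (primrecPred_iff ?_ (.or (.and ?_ ?_) (.and ?_ ?_)))))))
  · exact primrecPred_hasBit (hT.comp f4) (he'.comp f4) t4 i4 k4 snd
  · exact hdvd
  · exact primrecPred_hasBit (hT.comp f4) (he.comp f4) t4 hdiv k4 snd
  · exact hdvd.not
  · exact primrecPred_hasBit (hT.comp f4) (he.comp f4) t4 hdiv k4 (.const 1)

theorem primrec_codeBound (hT : Primrec Tr) (hℓ : Primrec ℓ) :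
    Primrec fun a => codeBound K (Tr a) (ℓ a) :=
  primrec_pow.comp (.const 2) (Primrec₂.natPair.comp hT (Primrec₂.natPair.comp hℓ (.const (2 * K))))

end Primrec

end Stack
end HyTime

namespace HyTime
namespace Stack

/-- The factor by which the length of words grows at each table. -/
def ratio (C c : ℕ) : ℕ := C ^ (c + 1) * idxBound C c + 1

/-- The length of the words in the `n`-th table for the formulas of code at most `c`. -/
def len (C c n : ℕ) : ℕ := 2 * ratio C c ^ (c - n + 1)

/-- A bound for the tracks used in formulas of code at most `c`. -/
def tracks (c : ℕ) : ℕ := 2 * (c + 1) + 1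

theorem len_mul {C c n m : ℕ} (h : m ≤ n) (hn : n ≤ c) :
    len C c n * ratio C c ^ (n - m) = len C c m := by
  rw [len, len, mul_assoc, ← pow_add]
  congr 2
  omega

theorem ratio_pow {C c d : ℕ} (hd : 0 < d) :
    ∃ p, C ^ (c + 1) * idxBound C c ≤ p ∧ ratio C c ^ d = p + 1 := by
  have h1 : 0 < ratio C c := Nat.succ_pos _
  have h2 := Nat.le_self_pow hd.ne' (ratio C c)
  refine ⟨ratio C c ^ d - 1, ?_, ?_⟩
  · rw [ratio] at h2 ⊢
    omega
  · omega

/-- Some word in the table for `m` pads the word of code `e` for `n`, except on track `j`. -/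
def Child (K C c : ℕ) (prev : List (List ℕ)) (n e j m : ℕ) : Prop :=
  ∃ d ∈ prev.getD m [], CodeAgree K (tracks c) (len C c n) (ratio C c ^ (n - m)) j e d

/-- The condition for `e` to be in the table of the formula of code `n`, given the previous tables. -/
def Step (K C c : ℕ) (prev : List (List ℕ)) (n e : ℕ) : Prop :=
  (n.unpair.1 = 0 ∧
    CodeBefore K (tracks c) (len C c n) e n.unpair.2.unpair.1 n.unpair.2.unpair.2) ∨
  (n.unpair.1 = 1 ∧
    CodeSucc K (tracks c) (len C c n) e n.unpair.2.unpair.1 n.unpair.2.unpair.2) ∨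
  (n.unpair.1 = 2 ∧
    CodeApp K (tracks c) (len C c n) e n.unpair.2.unpair.1 n.unpair.2.unpair.2) ∨
  (n.unpair.1 = 3 ∧ (Child K C c prev n e (tracks c) n.unpair.2.unpair.1 ∨
    Child K C c prev n e (tracks c) n.unpair.2.unpair.2)) ∨
  (n.unpair.1 = 4 ∧ ¬ Child K C c prev n e (tracks c) n.unpair.2) ∨
  (n.unpair.1 = 5 ∧ ∃ e' ∈ prev.getD n.unpair.2.unpair.2 [],
    CodeAgree K (tracks c) (len C c n) (ratio C c ^ (n - n.unpair.2.unpair.2))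
      (2 * n.unpair.2.unpair.1 + 2) e e' ∧
    CodeSingle K (tracks c) (len C c n.unpair.2.unpair.2) e' n.unpair.2.unpair.1) ∨
  (n.unpair.1 = 6 ∧ Child K C c prev n e (2 * n.unpair.2.unpair.1 + 1) n.unpair.2.unpair.2)

open Classical in
/-- The next table, given the list of the previous ones. -/
noncomputable def nextTable (K C c : ℕ) (prev : List (List ℕ)) : List ℕ :=
  (List.range (codeBound K (tracks c) (len C c prev.length))).filter
    (Step K C c prev prev.length ·)

/-- The first `n` tables. -/
noncomputable def tables (K C c : ℕ) : ℕ → List (List ℕ)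
  | 0 => []
  | n + 1 => tables K C c n ++ [nextTable K C c (tables K C c n)]

/-- The codes of the words satisfying the formula of code `n`. -/
noncomputable def table (K C c n : ℕ) : List ℕ := nextTable K C c (tables K C c n)

section Correct

theorem lt_pair_of_le {k n m : ℕ} (hk : 0 < k) (h : n ≤ m) : n < Nat.pair k m :=
  h.trans_lt (by have := Nat.add_le_pair k m; omega)

variable {K C c : ℕ}

theorem tables_eq_map (n : ℕ) : tables K C c n = (List.range n).map (table K C c) := by
  induction n with
  | zero => rfl
  | succ n ih => rw [List.range_succ, List.map_append, ← ih]; rfl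

theorem mem_table {n e : ℕ} : e ∈ table K C c n ↔
    e < codeBound K (tracks c) (len C c n) ∧ Step K C c (tables K C c n) n e := by
  simp [table, nextTable, tables_eq_map n]

theorem tables_getD {n m : ℕ} (h : m < n) : (tables K C c n).getD m [] = table K C c m := by
  rw [tables_eq_map, List.getD_eq_getElem _ _ (by simpa using h)]
  simp

theorem mem_table_encMSO (hpos : 0 < C)
    (hC : ∀ x y, Regular C (fun w : List (Letter K) => Before x y w) ∧
      Regular C (fun w : List (Letter K) => Single x w) ∧
      Regular C (fun w : List (Letter K) => Models (.succ x y) w) ∧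
      Regular C (fun w : List (Letter K) => Models (.app x y) w)) (φ : MSO ℕ) :
    ∀ e, encMSO φ ≤ c → (e ∈ table K C c (encMSO φ) ↔
      e < codeBound K (tracks c) (len C c (encMSO φ)) ∧
        Models φ (word K (tracks c) (len C c (encMSO φ)) e)) := by
  have bound : ∀ {ψ : MSO ℕ} {d : ℕ}, 0 < d → encMSO ψ ≤ c →
      ∃ p, C * idxBound C (encMSO ψ) ≤ p ∧ idxBound C (encMSO ψ) * C ≤ p ∧
        idxBound C (encMSO ψ) ≤ p ∧ ratio C c ^ d = p + 1 := by
    intro ψ d hd hψ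
    obtain ⟨p, hp, hp'⟩ := ratio_pow (C := C) (c := c) hd
    have h1 : C * idxBound C (encMSO ψ) ≤ p := le_trans
      (Nat.mul_le_mul (Nat.le_self_pow (by omega) C) (idxBound_mono hpos hψ)) hp
    exact ⟨p, h1, by rwa [mul_comm], le_trans (Nat.le_mul_of_pos_left _ hpos) h1, hp'⟩
  have child : ∀ {ψ : MSO ℕ} {n : ℕ}, encMSO ψ < n → n ≤ c →
      (∀ e, encMSO ψ ≤ c → (e ∈ table K C c (encMSO ψ) ↔
        e < codeBound K (tracks c) (len C c (encMSO ψ)) ∧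
        Models ψ (word K (tracks c) (len C c (encMSO ψ)) e))) → ∀ e,
      (Child K C c (tables K C c n) n e (tracks c) (encMSO ψ) ↔
        Models ψ (word K (tracks c) (len C c n) e)) ∧
      ∀ j < tracks c, (Child K C c (tables K C c n) n e j (encMSO ψ) ↔
        ∃ w', Refines {j} (word K (tracks c) (len C c n) e) w' ∧ Models ψ w') := by
    intro ψ n hn hc ih e
    have hψ : encMSO ψ ≤ c := hn.le.trans hc
    have hl := len_mul (C := C) hn.le hc
    obtain ⟨p, -, -, hp, hp'⟩ := bound (ψ := ψ) (Nat.sub_pos_of_lt hn) hψ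
    have hreg := models_regular hC ψ
    simp only [Child, tables_getD hn, ih _ hψ, ← hl, hp']
    refine ⟨?_, fun j hj => ?_⟩
    · rw [hreg.inv.word_iff (p := p)]
      exact exists_congr fun _ => by tauto
    · rw [hreg.refines_word_iff hp hj]
      exact exists_congr fun _ => by tauto
  induction φ with
  | lt x y =>
    intro e _
    simp [mem_table, Step, encMSO, Models, before_word]
  | succ x y =>
    intro e _
    simp [mem_table, Step, encMSO, succ_word]
  | app P x =>
    intro e _
    simp [mem_table, Step, encMSO, app_word]
  | disj φ ψ ihφ ihψ =>
    intro e hc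
    have h1 : encMSO φ < encMSO (.disj φ ψ) :=
      lt_pair_of_le (by norm_num) (Nat.left_le_pair _ _)
    have h2 : encMSO ψ < encMSO (.disj φ ψ) :=
      lt_pair_of_le (by norm_num) (Nat.right_le_pair _ _)
    have e1 := (child h1 hc ihφ e).1
    have e2 := (child h2 hc ihψ e).1
    rw [mem_table, Models, ← e1, ← e2]
    simp [Step, encMSO]
  | neg φ ih =>
    intro e hc
    have h1 : encMSO φ < encMSO (.neg φ) :=
      lt_pair_of_le (by norm_num) le_rfl
    rw [mem_table, Models, ← (child h1 hc ih e).1]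
    simp [Step, encMSO]
  | exFO x φ ih =>
    intro e hc
    have h1 : encMSO φ < encMSO (.exFO x φ) :=
      lt_pair_of_le (by norm_num) (Nat.right_le_pair _ _)
    have hx : x < encMSO (.exFO x φ) :=
      lt_pair_of_le (by norm_num) (Nat.left_le_pair _ _)
    have hψ : encMSO φ ≤ c := h1.le.trans hc
    have hl := len_mul (C := C) h1.le hc
    obtain ⟨p, hp, -, -, hp'⟩ := bound (ψ := φ) (Nat.sub_pos_of_lt h1) hψ
    have hreg := (hC x x).2.1.and (models_regular hC φ)
    have hj : 2 * x + 2 < tracks c := by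
      rw [tracks]
      omega
    rw [mem_table, Models, hreg.refines_word_iff hp hj, ← hp', hl]
    have hs : Step K C c (tables K C c (encMSO (.exFO x φ))) (encMSO (.exFO x φ)) e ↔
        ∃ e' ∈ table K C c (encMSO φ), CodeAgree K (tracks c) (len C c (encMSO (.exFO x φ)))
          (ratio C c ^ (encMSO (.exFO x φ) - encMSO φ)) (2 * x + 2) e e' ∧
          CodeSingle K (tracks c) (len C c (encMSO φ)) e' x := by
      rw [← tables_getD h1]
      simp [Step, encMSO]
    rw [hs]
    simp only [ih _ hψ, single_word]
    exact and_congr_right fun _ => exists_congr fun _ => by tauto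
  | exSO P φ ih =>
    intro e hc
    have h1 : encMSO φ < encMSO (.exSO P φ) :=
      lt_pair_of_le (by norm_num) (Nat.right_le_pair _ _)
    have hx : P < encMSO (.exSO P φ) :=
      lt_pair_of_le (by norm_num) (Nat.left_le_pair _ _)
    have hj : 2 * P + 1 < tracks c := by
      rw [tracks]
      omega
    rw [mem_table, Models, ← (child h1 hc ih e).2 _ hj]
    simp [Step, encMSO]

end Correct

end Stack
end HyTime

namespace HyTime
namespace Stack

section Primrec

open Primrec

theorem primrec_idxBound (C : ℕ) : Primrec (idxBound C) :=
  (nat_rec₁ C (f := fun _ B => 2 ^ (C * (B * B))) (primrec_pow.comp (.const 2)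
    (nat_mul.comp (.const C) (nat_mul.comp snd snd)))).of_eq fun n => by
      induction n with
      | zero => rfl
      | succ n ih => rw [idxBound, ← ih]

variable {α : Type*} [Primcodable α] {K C : ℕ} {c n e : α → ℕ}

theorem primrec_ratio (hc : Primrec c) : Primrec fun a => ratio C (c a) :=
  succ.comp (nat_mul.comp (primrec_pow.comp (.const C) (succ.comp hc))
    ((primrec_idxBound C).comp hc))

theorem primrec_len (hc : Primrec c) (hn : Primrec n) : Primrec fun a => len C (c a) (n a) :=
  nat_mul.comp (.const 2) (primrec_pow.comp (primrec_ratio hc) (succ.comp (nat_sub.comp hc hn)))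

theorem primrec_tracks (hc : Primrec c) : Primrec fun a => tracks (c a) :=
  succ.comp (nat_mul.comp (.const 2) (succ.comp hc))

theorem primrecPred_child {prev : α → List (List ℕ)} {j m : α → ℕ} (hc : Primrec c)
    (hprev : Primrec prev) (hn : Primrec n) (he : Primrec e) (hj : Primrec j) (hm : Primrec m) :
    PrimrecPred fun a => Child K C (c a) (prev a) (n a) (e a) (j a) (m a) :=
  primrecPred_exists_mem ((list_getD []).comp hprev hm)
    (primrecPred_codeAgree ((primrec_tracks hc).comp fst) ((primrec_len hc hn).comp fst)
      ((primrec_pow.comp (primrec_ratio hc) (nat_sub.comp hn hm)).comp fst) (hj.comp fst)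
      (he.comp fst) snd)

theorem primrecPred_step {prev : α → List (List ℕ)} (hc : Primrec c)
    (hprev : Primrec prev) (hn : Primrec n) (he : Primrec e) :
    PrimrecPred fun a => Step K C (c a) (prev a) (n a) (e a) := by
  have hT := primrec_tracks hc
  have hℓ := primrec_len (C := C) hc hn
  have h1 : Primrec fun a => (n a).unpair.1 := fst.comp (unpair.comp hn)
  have h2 : Primrec fun a => (n a).unpair.2 := snd.comp (unpair.comp hn)
  have h3 : Primrec fun a => (n a).unpair.2.unpair.1 := fst.comp (unpair.comp h2)
  have h4 : Primrec fun a => (n a).unpair.2.unpair.2 := snd.comp (unpair.comp h2)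
  have heq := fun i => Primrec.eq.comp h1 (.const i)
  have hd := fun k : ℕ => nat_add.comp (nat_mul.comp (.const 2) h3) (.const k)
  refine .or ((heq 0).and (primrecPred_codeBefore hT hℓ he h3 h4))
    (.or ((heq 1).and (primrecPred_codeSucc hT hℓ he h3 h4))
    (.or ((heq 2).and (primrecPred_codeApp hT hℓ he h3 h4))
    (.or ((heq 3).and ((primrecPred_child hc hprev hn he hT h3).or
      (primrecPred_child hc hprev hn he hT h4)))
    (.or ((heq 4).and (primrecPred_child hc hprev hn he hT h2).not)
    (.or ((heq 5).and (primrecPred_exists_mem ((list_getD []).comp hprev h4) (.and ?_ ?_)))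
    ((heq 6).and (primrecPred_child hc hprev hn he (hd 1) h4)))))))
  · exact primrecPred_codeAgree (hT.comp fst) (hℓ.comp fst)
      ((primrec_pow.comp (primrec_ratio hc) (nat_sub.comp hn h4)).comp fst) ((hd 2).comp fst)
      (he.comp fst) snd
  · exact primrecPred_codeSingle (hT.comp fst) ((primrec_len hc h4).comp fst) snd (h3.comp fst)

theorem primrec_nextTable {prev : α → List (List ℕ)} (hc : Primrec c) (hprev : Primrec prev) :
    Primrec fun a => nextTable K C (c a) (prev a) := by
  classical
  have hl := list_length.comp hprev
  exact primrec_filter (list_range.comp (primrec_codeBound (primrec_tracks hc) (primrec_len hc hl)))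
    (primrecPred_step (hc.comp fst) (hprev.comp fst) (hl.comp fst) snd)

theorem primrec_table (hc : Primrec c) (hn : Primrec n) :
    Primrec fun a => table K C (c a) (n a) := by
  have h : Primrec fun a => tables K C (c a) (n a) := by
    refine (nat_rec' (g := fun _ => ([] : List (List ℕ)))
      (h := fun a p => p.2 ++ [nextTable K C (c a) p.2]) hn (.const [])
      (list_concat.comp (snd.comp snd)
        (primrec_nextTable (hc.comp fst) (snd.comp snd)))).of_eq fun a => ?_
    induction n a with
    | zero => rfl
    | succ m ih => rw [tables, ← ih]
  exact primrec_nextTable hc h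

end Primrec

end Stack
end HyTime

namespace HyTime
namespace Stack

variable {K : ℕ}

/-- A letter describing the time domain: the levels below `M` belong to it, the other ones do so
in the first `n` letters. -/
def domLetter (K M n i : ℕ) : Letter K := fun t k _ => t == 0 && decide (i < n ∨ (k : ℕ) < M)

/-- The word with two letters describing the time domain. -/
def domWord (K K' : ℕ) : List (Letter K) := [domLetter K K' 1 0, domLetter K K' 1 1]

theorem pad_domWord (K' p : ℕ) :
    pad p (domWord K K') = (List.range (2 * (p + 1))).map (domLetter K K' (p + 1)) := by
  have h : pad p (domWord K K') = List.replicate (p + 1) (domLetter K K' 1 0) ++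
      List.replicate (p + 1) (domLetter K K' 1 1) := by
    simp only [pad, domWord, List.flatMap_cons, List.flatMap_nil, List.append_nil,
      List.replicate_succ]
    rfl
  rw [h]
  refine List.ext_getElem (by simp; omega) fun i h1 h2 => ?_
  rw [List.getElem_append, List.getElem_map, List.getElem_range]
  split_ifs with hi
  · have hlt : i < p + 1 := by simpa using hi
    rw [List.getElem_replicate]
    funext t k b
    simp [domLetter, hlt]
  · have hlt : ¬ i < p + 1 := by simpa using hi
    rw [List.getElem_replicate]
    funext t k b
    simp [domLetter, hlt]

/-- The test performed on the table of the formula of code `c`. -/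
def Accept (K K' C c : ℕ) : Prop :=
  ∃ e ∈ table K C c c, (∀ i < len C c c, ∀ k < K, ∀ b < 2,
    (HasBit (tracks c) e 0 i k b ↔ i < ratio C c ∨ k < K')) ∧
    ∀ x < c + 1, CodeSingle K (tracks c) (len C c c) e x

theorem accept_encMSO {K' C : ℕ} (hpos : 0 < C)
    (hC : ∀ x y, Regular C (fun w : List (Letter K) => Before x y w) ∧
      Regular C (fun w : List (Letter K) => Single x w) ∧
      Regular C (fun w : List (Letter K) => Models (.succ x y) w) ∧
      Regular C (fun w : List (Letter K) => Models (.app x y) w)) (φ : MSO ℕ) :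
    Accept K K' C (encMSO φ) ↔
      ∃ w', Refines {t | t ≠ 0 ∧ t < tracks (encMSO φ)} (domWord K K') w' ∧
        Models φ w' ∧ ∀ x : Fin (encMSO φ + 1), Single x w' := by
  have hreg := (models_regular hC φ).and (Regular.forall_fin fun x : Fin (encMSO φ + 1) =>
    (hC x x).2.1)
  set c := encMSO φ with hc
  have hr : ratio C c = idxBound C c * C ^ (c + 1) + 1 := by rw [ratio, mul_comm]
  have hlen : len C c c = 2 * ratio C c := by simp [len]
  have hagree : ∀ e, List.Forall₂ (EqOff {t | t ≠ 0 ∧ t < tracks c})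
      (pad (idxBound C c * C ^ (c + 1)) (domWord K K')) (word K (tracks c) (len C c c) e) ↔
      ∀ i < len C c c, ∀ k < K, ∀ b < 2,
        (HasBit (tracks c) e 0 i k b ↔ i < ratio C c ∨ k < K') := by
    intro e
    rw [pad_domWord, ← hr, ← hlen, word, List.forall₂_map_left_iff, List.forall₂_map_right_iff,
      List.forall₂_same]
    simp only [List.mem_range]
    refine forall_congr' fun i => imp_congr_right fun _ => ⟨fun h k hk b hb => ?_, fun h t ht => ?_⟩
    · have h1 := congrFun (congrFun (h 0 (by simp)) ⟨k, hk⟩) (b == 1)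
      have hb' : (b == 1).toNat = b := by
        interval_cases b <;> rfl
      rw [Bool.eq_iff_iff, letter_eq_true, hb'] at h1
      simpa [domLetter] using h1.symm
    · funext k b
      rw [Bool.eq_iff_iff, letter_eq_true]
      by_cases h0 : t = 0
      · subst h0
        rw [h k k.2 _ (Bool.toNat_lt b)]
        simp [domLetter]
      · have h1 : ¬ t < tracks c := fun h1 => ht ⟨h0, h1⟩
        simp [h0, h1, HasBit, domLetter]
  rw [hreg.exists_refines_iff le_rfl]
  constructor
  · rintro ⟨e, he, h1, h2⟩
    rw [hc, mem_table_encMSO hpos hC φ e le_rfl] at he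
    exact ⟨_, (hagree e).2 h1, he.2, fun x => single_word.2 (h2 x x.2)⟩
  · rintro ⟨w', h1, h2, h3⟩
    have hl : (pad (idxBound C c * C ^ (c + 1)) (domWord K K')).length = len C c c := by
      rw [pad_domWord, ← hr, ← hlen]
      simp
    obtain ⟨e, he, rfl⟩ := exists_code (Tr := tracks c) h1 (by
      intro a ha t ht k b
      rw [pad_domWord] at ha
      obtain ⟨i, -, rfl⟩ := List.mem_map.1 ha
      have : t ≠ 0 := by
        rw [tracks] at ht
        omega
      simp [this, domLetter]) fun t ht => ht.2
    rw [hl] at *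
    refine ⟨e, ?_, (hagree e).1 h1, fun x hx => single_word.1 (h3 ⟨x, hx⟩)⟩
    rw [hc, mem_table_encMSO hpos hC φ e le_rfl]
    exact ⟨he, h2⟩

section Primrec

open Primrec

theorem primrecPred_accept (K K' C : ℕ) : PrimrecPred (Accept K K' C) := by
  have hc : Primrec fun c : ℕ => c := .id
  have f4 : Primrec fun x : (((ℕ × ℕ) × ℕ) × ℕ) × ℕ => x.1.1.1.1 :=
    fst.comp (fst.comp (fst.comp fst))
  have e4 : Primrec fun x : (((ℕ × ℕ) × ℕ) × ℕ) × ℕ => x.1.1.1.2 :=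
    snd.comp (fst.comp (fst.comp fst))
  have i4 : Primrec fun x : (((ℕ × ℕ) × ℕ) × ℕ) × ℕ => x.1.1.2 := snd.comp (fst.comp fst)
  have k4 : Primrec fun x : (((ℕ × ℕ) × ℕ) × ℕ) × ℕ => x.1.2 := snd.comp fst
  have hl := primrec_len (C := C) hc hc
  refine primrecPred_exists_mem (primrec_table hc hc) (.and
    (primrecPred_forall_lt (hl.comp fst) (primrecPred_forall_lt (.const K)
      (primrecPred_forall_lt (.const 2) (primrecPred_iff ?_ (.or ?_ ?_)))))
    (primrecPred_forall_lt (succ.comp fst) ?_))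
  · exact primrecPred_hasBit (primrec_tracks f4) e4 (.const 0) i4 k4 snd
  · exact nat_lt.comp i4 (primrec_ratio f4)
  · exact nat_lt.comp k4 (.const K')
  · exact primrecPred_codeSingle (primrec_tracks (fst.comp fst)) (hl.comp (fst.comp fst))
      (snd.comp fst) snd

end Primrec

end Stack
end HyTime

namespace HyTime
namespace Stack

variable {K : ℕ}

theorem bounded_of_encMSO_lt {T : ℕ} (φ : MSO ℕ) (h : encMSO φ < T) : Bounded T φ := by
  have hl : ∀ {k n m : ℕ}, Nat.pair k (Nat.pair n m) < T → n < T ∧ m < T := fun {k n m} h =>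
    ⟨((Nat.left_le_pair n m).trans (Nat.right_le_pair k _)).trans_lt h,
      ((Nat.right_le_pair n m).trans (Nat.right_le_pair k _)).trans_lt h⟩
  induction φ with
  | lt x y => exact hl h
  | succ x y => exact hl h
  | app P x => exact hl h
  | disj φ ψ ih1 ih2 => exact ⟨ih1 (hl h).1, ih2 (hl h).2⟩
  | neg φ ih => exact ih ((Nat.right_le_pair 4 _).trans_lt h)
  | exFO x φ ih => exact ⟨(hl h).1, ih (hl h).2⟩
  | exSO P φ ih => exact ⟨(hl h).1, ih (hl h).2⟩

/-- The stacked flow describing only the time domain `[0, N)`. -/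
def domFlow (K : ℕ) (N : ℝ) : SFlow K := fun t k s => t = 0 ∧ s + k < N

theorem exists_realizes_domFlow {N : ℝ} (hN : 0 < N) :
    ∃ K', Realizes (domFlow ⌈N⌉₊ N) 0 1 (domWord ⌈N⌉₊ K') := by
  obtain ⟨K, hK⟩ : ∃ K, ⌈N⌉₊ = K + 1 := Nat.exists_eq_succ_of_ne_zero (Nat.ceil_pos.2 hN).ne'
  have h1 : N ≤ K + 1 := by
    have := Nat.le_ceil N
    rw [hK] at this
    exact_mod_cast this
  have h2 : K < N := Nat.lt_ceil.1 (by omega)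
  rw [hK]
  have key : ∃ c K', 0 < c ∧ c < 1 ∧ ∀ (k : Fin (K + 1)) (s : ℝ), 0 ≤ s → s < 1 →
      (s + k < N ↔ s < c ∨ (k : ℕ) < K') := by
    have hk : ∀ k : Fin (K + 1), (k : ℕ) ≠ K → ((k : ℕ) : ℝ) + 1 ≤ K := fun k h => by
      have := k.2
      exact_mod_cast (show (k : ℕ) + 1 ≤ K by omega)
    by_cases hNK : N = K + 1
    · refine ⟨1 / 2, K + 1, by norm_num, by norm_num, fun k s h0 hs => ?_⟩
      have : ((k : ℕ) : ℝ) ≤ K := by exact_mod_cast Nat.le_of_lt_succ k.2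
      exact iff_of_true (by linarith) (Or.inr k.2)
    · refine ⟨N - K, K, by linarith, ?_, fun k s h0 hs => ?_⟩
      · linarith [lt_of_le_of_ne h1 hNK]
      · by_cases hkK : (k : ℕ) = K
        · rw [hkK, lt_sub_iff_add_lt]
          simp
        · exact iff_of_true (by linarith [hk k hkK]) (Or.inr (by have := k.2; omega))
  obtain ⟨c, K', hc0, hc1, hc⟩ := key
  refine ⟨K', c, hc0, fun t k => ⟨?_, fun r h3 h4 => ?_⟩, 1, hc1,
    fun t k => ⟨?_, fun r h3 h4 => ?_⟩, rfl⟩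
  · have h0 := (hc k 0 le_rfl one_pos).2 (Or.inl hc0)
    rw [zero_add] at h0
    simp [domFlow, domLetter, h0]
  · simp [domFlow, domLetter, hc k r h3.le (h4.trans hc1), h4]
  · simp [domFlow, domLetter, hc k c hc0.le hc1]
  · simp [domFlow, domLetter, hc k r (hc0.trans h3).le h4, not_lt.2 h3.le]

theorem exists_sat_iff {N : ℝ} (hNK : N ≤ K) {T : ℕ} {φ : MSO ℕ} (hφ : Bounded T φ) (hN : 0 < N)
    {w : List (Letter K)} (hw : Realizes (domFlow K N) 0 1 w) :
    (∃ f : ℝ → Set ℕ, FinVar (Set.Ico 0 N) f ∧ ∃ I : ℕ → ℝ, (∀ v, I v ∈ Set.Ico 0 N) ∧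
      MSO.Sat (Set.Ico 0 N) φ f I) ↔
    ∃ w', Refines {t | t ≠ 0 ∧ t < 2 * T + 1} w w' ∧ Models φ w' ∧
      ∀ x : Fin T, Single x w' := by
  constructor
  · rintro ⟨f, hf, I, hI, hsat⟩
    obtain ⟨Z, hZ⟩ := FinVar.exists_finset hf
    let F : SFlow K := fun t k r => (t = 0 ∧ r + k < N) ∨
      (∃ P < T, t = 2 * P + 1 ∧ r + k < N ∧ P ∈ f (r + k)) ∨ ∃ x < T, t = 2 * x + 2 ∧ I x = r + k
    have hc : ConstOff (stackCuts K (insert N (Z ∪ (Finset.range T).image I))) F 0 1 := by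
      intro r r' h1 h2 h3 hz t k
      have h4 : (r + k < N ↔ r' + k < N) := by
        rcases of_stackCuts hz k (Finset.mem_insert_self _ _) with h | h
        · exact iff_of_false (by linarith) (by linarith)
        · exact iff_of_true (by linarith) (by linarith)
      have h5 : r' + k < N → f (r + k) = f (r' + k) := fun h =>
        hZ _ _ (by positivity) (by linarith) h fun z hz' => of_stackCuts hz k
          (Finset.mem_insert_of_mem (Finset.mem_union_left _ hz'))
      have h6 : ∀ x < T, I x ≠ r + k ∧ I x ≠ r' + k := fun x hx => by
        rcases of_stackCuts hz k (Finset.mem_insert_of_mem (Finset.mem_union_right _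
          (Finset.mem_image_of_mem I (Finset.mem_range.2 hx)))) with h | h
        · exact ⟨by linarith, by linarith⟩
        · exact ⟨by linarith, by linarith⟩
      refine or_congr (and_congr_right fun _ => h4) (or_congr (exists_congr fun P =>
        and_congr_right fun _ => and_congr_right fun _ => ?_) (exists_congr fun x =>
        and_congr_right fun hx => and_congr_right fun _ =>
          iff_of_false (h6 x hx).1 (h6 x hx).2))
      rw [h4]
      exact and_congr_right fun h => by rw [h5 h]
    obtain ⟨w', hw1, hw2⟩ := hw.exists_refines (J := {t | t ≠ 0 ∧ t < 2 * T + 1}) hc (by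
      intro t ht k r _ _
      by_cases h0 : t = 0
      · subst h0
        simp [F, domFlow]
      · have h1 : ¬ t < 2 * T + 1 := fun h => ht ⟨h0, h⟩
        refine iff_of_false ?_ (fun h => h0 h.1)
        rintro (h | ⟨P, hP, h, -⟩ | ⟨x, hx, h, -⟩)
        · exact h0 h.1
        · omega
        · omega)
    have hrep : Represents N T F f I := by
      refine ⟨fun k s _ _ => ?_, fun P hP k s _ _ hlt => ?_, fun x hx => ⟨hI x, fun k s _ _ => ?_⟩⟩
      · constructor
        · rintro (h | ⟨P, hP, h, -⟩ | ⟨x, hx, h, -⟩)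
          · exact h.2
          · omega
          · omega
        · exact fun h => Or.inl ⟨rfl, h⟩
      · constructor
        · rintro (h | ⟨Q, hQ, h, -, h'⟩ | ⟨x, hx, h, -⟩)
          · omega
          · rwa [show P = Q by omega]
          · omega
        · exact fun h => Or.inr (Or.inl ⟨P, hP, rfl, hlt, h⟩)
      · constructor
        · rintro (h | ⟨Q, hQ, h, -, h'⟩ | ⟨y, hy, h, h'⟩)
          · omega
          · omega
          · rwa [show x = y by omega]
        · exact fun h => Or.inr (Or.inr ⟨x, hx, rfl, h⟩)
    refine ⟨w', hw1, (sat_iff_models hNK φ hφ hf hw2 hrep).1 hsat, fun x => ?_⟩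
    obtain ⟨tw, rfl, htw⟩ := hw2.timed
    exact (single_iff hNK htw hrep.dom).2 ⟨I x, hrep.var x x.2⟩
  · rintro ⟨w', hw1, hmod, hsing⟩
    obtain ⟨F, hF, hw2⟩ := Realizes.of_refines hw1 hw
    have hdom : ∀ (k : Fin K) (s : ℝ), 0 ≤ s → s < 1 → (F 0 k s ↔ s + k < N) := fun k s _ _ => by
      rw [hF 0 fun h => h.1 rfl]
      simp [domFlow]
    have hvar : ∀ x : ℕ, ∃ r ∈ Set.Ico 0 N, x < T → PointTrack F x r := fun x => by
      obtain ⟨tw, rfl, htw⟩ := hw2.timed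
      by_cases hx : x < T
      · obtain ⟨r, hr, h⟩ := (single_iff hNK htw hdom).1 (hsing ⟨x, hx⟩)
        exact ⟨r, hr, fun _ => h⟩
      · exact ⟨0, ⟨le_rfl, hN⟩, fun h => absurd h hx⟩
    choose I hI hI' using hvar
    have hf : FinVar (Set.Ico 0 N) (readPreds F Set.univ fun _ => ∅) :=
      readPreds_finVar hNK hw2 (FinVar.of_finset ∅ fun _ _ _ _ _ _ => rfl)
    refine ⟨_, hf, I, hI, (sat_iff_models hNK φ hφ hf hw2
      ⟨hdom, fun P _ k s hs hs' _ => ?_, fun x hx => ⟨hI x, hI' x hx⟩⟩).2 hmod⟩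
    exact (mem_readPreds (Set.mem_univ P) hs hs').symm

end Stack

end HyTime

namespace HyTime

/-- For every `N > 0`, the satisfiability problem for MSO(<,+1) over the
bounded time domain `[0,N)` is decidable: there is a computable function which, on the
code of an MSO(<,+1) formula `φ`, decides whether there exist a flow
`f : [0,N) → 𝒫(MP)` and an interpretation `I : Vars → [0,N)` with `f, I ⊨ φ`. -/
theorem MSO_bounded_satisfiability_decidable (N : ℝ) (hN : 0 < N) :
    ∃ dec : ℕ → Bool, Computable dec ∧
      ∀ φ : MSO ℕ,
        (dec (encMSO φ) = true ↔
          ∃ f : ℝ → Set ℕ, FinVar (Set.Ico (0 : ℝ) N) f ∧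
          ∃ ivar : ℕ → ℝ, (∀ v, ivar v ∈ Set.Ico (0 : ℝ) N) ∧
            MSO.Sat (Set.Ico 0 N) φ f ivar) := by
  classical
  obtain ⟨C, hC⟩ := Stack.exists_regular_atoms ⌈N⌉₊
  obtain ⟨K', hK'⟩ := Stack.exists_realizes_domFlow hN
  refine ⟨fun c => decide (Stack.Accept ⌈N⌉₊ K' C c),
    (Stack.primrecPred_accept ⌈N⌉₊ K' C).decide.to_comp, fun φ => ?_⟩
  rw [decide_eq_true_iff, Stack.accept_encMSO (hC 0 0).1.pos hC φ]
  exact (Stack.exists_sat_iff (Nat.le_ceil N)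
    (Stack.bounded_of_encMSO_lt φ (Nat.lt_succ_self _)) hN hK').symm

end HyTime
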